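/- arXiv:2303.12558 — 2 statements merged into one kernel-verified Lean document; each statement's English description precedes it below -/
import Mathlib

section
/- Let (S, d_S) be a Polish metric space of states, A a standard Borel space of actions, and let (Z̄, d_Z̄) and (B̄, d_B̄) be Polish metric spaces with bounded metrics (latent states and latent actions). Let ξ be a probability measure on S × A, φ : S → Z̄ a measurable state embedding, κ a Markov kernel from Z̄ × A to B̄ (action encoder), P a Markov kernel from S × A to S (transition kernel), P̄ a Markov kernel from Z̄ × B̄ to Z̄ (latent transition kernel), and χ any probability measure on Z̄ × B̄ × Z̄. Equip Z̄ × B̄ × Z̄ with the metric d̄((z,b,z'),(w,c,w')) = d_Z̄(z,w) + d_B̄(b,c) + d_Z̄(z',w'). Let Q be the law of (φ(s), b, φ(s')) when (s,a) ∼ ξ, b ∼ κ(·| φ(s), a) and s' ∼ P(·| s, a), and let η be the law of (φ(s), b, z̄') when (s,a) ∼ ξ, b ∼ κ(·| φ(s), a) and z̄' ∼ P̄(·| φ(s), b). Then W_{d̄}(Q, χ) ≤ W_{d̄}(χ, η) + L_P, where L_P = ∫_{S×A} ∫_{B̄} W_{d_Z̄}( φ_*P(·|s,a), P̄(·| φ(s),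 b) ) κ(db | φ(s), a) dξ(s,a) and φ_*P(·|s,a) denotes the pushforward of P(·|s,a) under φ. -/
open MeasureTheory ProbabilityTheory ENNReal Filter

/-- The Wasserstein "distance" between two measures w.r.t. a cost `d`,
defined as the infimum over couplings (probability measures on the product
with the prescribed marginals) of the transport cost, valued in `[0, ∞]`. -/
noncomputable def wasserstein {X : Type*} [MeasurableSpace X]
    (d : X → X → ℝ) (P Q : Measure X) : ℝ≥0∞ :=
  ⨅ γ ∈ {γ : Measure (X × X) |
      IsProbabilityMeasure γ ∧ γ.map Prod.fst = P ∧ γ.map Prod.snd = Q},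
    ∫⁻ p, ENNReal.ofReal (d p.1 p.2) ∂γ

/-- residual-corrected density -/
noncomputable def corrDens {Y Z : Type*} [MeasurableSpace Y] [MeasurableSpace Z]
    (μ : Measure Y) (ν : Measure Z) (f : Y → Z → ℝ≥0∞) (p : Y × Z) : ℝ≥0∞ :=
  f p.1 p.2 + (1 - ∫⁻ z, f p.1 z ∂ν) * (1 - ∫⁻ y, f y p.2 ∂μ) * (1 - ∫⁻ y, ∫⁻ z, f y z ∂ν ∂μ)⁻¹

lemma corrDens_swap {Y Z : Type*} [MeasurableSpace Y] [MeasurableSpace Z]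
    (μ : Measure Y) (ν : Measure Z) [IsProbabilityMeasure μ] [IsProbabilityMeasure ν]
    (f : Y → Z → ℝ≥0∞) (hf : Measurable (Function.uncurry f)) (y : Y) (z : Z) :
    corrDens μ ν f (y, z) = corrDens ν μ (fun z y => f y z) (z, y) := by
  unfold corrDens
  simp only
  rw [lintegral_lintegral_swap hf.aemeasurable]
  ring

lemma measurable_corrDens {Y Z : Type*} [MeasurableSpace Y] [MeasurableSpace Z]
    (μ : Measure Y) (ν : Measure Z) [IsProbabilityMeasure μ] [IsProbabilityMeasure ν]
    (f : Y → Z → ℝ≥0∞) (hf : Measurable (Function.uncurry f)) :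
    Measurable (corrDens μ ν f) := by
  unfold corrDens
  have h1 : Measurable (fun y => ∫⁻ z, f y z ∂ν) := hf.lintegral_prod_right'
  have h2 : Measurable (fun z => ∫⁻ y, f y z ∂μ) := hf.lintegral_prod_left'
  have h3 : Measurable (fun p : Y × Z => f p.1 p.2) := hf
  exact h3.add ((((measurable_const.sub (h1.comp measurable_fst))).mul
    (measurable_const.sub (h2.comp measurable_snd))).mul_const _)

lemma lintegral_one_sub {Y : Type*} [MeasurableSpace Y] (μ : Measure Y) [IsProbabilityMeasure μ]
    (h : Y → ℝ≥0∞) (hm : Measurable h) (h1 : ∀ y, h y ≤ 1) :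
    ∫⁻ y, (1 - h y) ∂μ = 1 - ∫⁻ y, h y ∂μ := by
  rw [lintegral_sub hm]
  · simp
  · exact ne_of_lt (lt_of_le_of_lt (lintegral_mono h1) (by simp))
  · exact Eventually.of_forall h1

lemma corrDens_row {Y Z : Type*} [MeasurableSpace Y] [MeasurableSpace Z]
    (μ : Measure Y) (ν : Measure Z) [IsProbabilityMeasure μ] [IsProbabilityMeasure ν]
    (f : Y → Z → ℝ≥0∞) (hf : Measurable (Function.uncurry f))
    (hr : ∀ y, ∫⁻ z, f y z ∂ν ≤ 1) (hc : ∀ z, ∫⁻ y, f y z ∂μ ≤ 1) :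
    ∀ᵐ y ∂μ, ∫⁻ z, corrDens μ ν f (y, z) ∂ν = 1 := by
  have h1 : Measurable (fun y => ∫⁻ z, f y z ∂ν) := hf.lintegral_prod_right'
  have h2 : Measurable (fun z => ∫⁻ y, f y z ∂μ) := hf.lintegral_prod_left'
  have hb : ∫⁻ z, (1 - ∫⁻ y, f y z ∂μ) ∂ν = 1 - ∫⁻ y, ∫⁻ z, f y z ∂ν ∂μ := by
    rw [lintegral_one_sub ν _ h2 hc, lintegral_lintegral_swap hf.aemeasurable]
  have ha : ∫⁻ y, (1 - ∫⁻ z, f y z ∂ν) ∂μ = 1 - ∫⁻ y, ∫⁻ z, f y z ∂ν ∂μ :=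
    lintegral_one_sub μ _ h1 hr
  have key : ∀ y, ∫⁻ z, corrDens μ ν f (y, z) ∂ν = ∫⁻ z, f y z ∂ν + (1 - ∫⁻ z, f y z ∂ν) *
      ((1 - ∫⁻ y, ∫⁻ z, f y z ∂ν ∂μ) * (1 - ∫⁻ y, ∫⁻ z, f y z ∂ν ∂μ)⁻¹) := by
    intro y
    unfold corrDens
    simp only
    have hfy : Measurable (fun z => f y z) := hf.comp measurable_prodMk_left
    rw [lintegral_add_left hfy]
    congr 1
    rw [lintegral_mul_const, lintegral_const_mul, hb, mul_assoc]
    · exact measurable_const.sub h2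
    · exact (measurable_const.sub h2).const_mul _
  by_cases hR : 1 - ∫⁻ y, ∫⁻ z, f y z ∂ν ∂μ = 0
  · have hm1 : Measurable (fun y => 1 - ∫⁻ z, f y z ∂ν) := measurable_const.sub h1
    rw [hR, lintegral_eq_zero_iff hm1] at ha
    filter_upwards [ha] with y hy
    have hy' : 1 - ∫⁻ z, f y z ∂ν = 0 := hy
    rw [key, hy', zero_mul, add_zero]
    exact le_antisymm (hr y) (tsub_eq_zero_iff_le.1 hy')
  · refine Eventually.of_forall fun y => ?_
    rw [key, ENNReal.mul_inv_cancel hR (ne_of_lt (lt_of_le_of_lt tsub_le_self (by simp))), mul_one]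
    exact add_tsub_cancel_of_le (hr y)

lemma withDensity_fst {Y Z : Type*} [MeasurableSpace Y] [MeasurableSpace Z]
    (μ : Measure Y) (ν : Measure Z) [IsProbabilityMeasure μ] [IsProbabilityMeasure ν]
    (g : Y × Z → ℝ≥0∞) (hg : Measurable g) (h : ∀ᵐ y ∂μ, ∫⁻ z, g (y, z) ∂ν = 1) :
    ((μ.prod ν).withDensity g).map Prod.fst = μ := by
  ext s hs
  rw [Measure.map_apply measurable_fst hs, withDensity_apply _ (measurable_fst hs),
    ← lintegral_indicator (measurable_fst hs),
    lintegral_prod _ (hg.indicator (measurable_fst hs)).aemeasurable]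
  rw [← lintegral_indicator_one hs]
  apply lintegral_congr_ae
  filter_upwards [h] with y hy
  by_cases hys : y ∈ s
  · simp [Set.indicator, hys, hy]
  · simp [Set.indicator, hys]

lemma withDensity_snd {Y Z : Type*} [MeasurableSpace Y] [MeasurableSpace Z]
    (μ : Measure Y) (ν : Measure Z) [IsProbabilityMeasure μ] [IsProbabilityMeasure ν]
    (g : Y × Z → ℝ≥0∞) (hg : Measurable g) (h : ∀ᵐ z ∂ν, ∫⁻ y, g (y, z) ∂μ = 1) :
    ((μ.prod ν).withDensity g).map Prod.snd = ν := by
  ext s hs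
  rw [Measure.map_apply measurable_snd hs, withDensity_apply _ (measurable_snd hs),
    ← lintegral_indicator (measurable_snd hs),
    lintegral_prod_symm _ (hg.indicator (measurable_snd hs)).aemeasurable]
  rw [← lintegral_indicator_one hs]
  apply lintegral_congr_ae
  filter_upwards [h] with y hy
  by_cases hys : y ∈ s
  · simp [Set.indicator, hys, hy]
  · simp [Set.indicator, hys]

lemma corrDens_cost {Y Z : Type*} [MeasurableSpace Y] [MeasurableSpace Z]
    (μ : Measure Y) (ν : Measure Z) [IsProbabilityMeasure μ] [IsProbabilityMeasure ν]
    (f : Y → Z → ℝ≥0∞) (hf : Measurable (Function.uncurry f))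
    (hr : ∀ y, ∫⁻ z, f y z ∂ν ≤ 1) (hc : ∀ z, ∫⁻ y, f y z ∂μ ≤ 1)
    (d : Y × Z → ℝ≥0∞) (hd : Measurable d) (C : ℝ≥0∞) (hC : ∀ p, d p ≤ C) :
    ∫⁻ p, d p ∂((μ.prod ν).withDensity (corrDens μ ν f)) ≤
      ∫⁻ y, ∫⁻ z, f y z * d (y, z) ∂ν ∂μ + C * (1 - ∫⁻ y, ∫⁻ z, f y z ∂ν ∂μ) := by
  have h1 : Measurable (fun y => ∫⁻ z, f y z ∂ν) := hf.lintegral_prod_right'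
  have h2 : Measurable (fun z => ∫⁻ y, f y z ∂μ) := hf.lintegral_prod_left'
  have h3 : Measurable (fun p : Y × Z => f p.1 p.2) := hf
  have hb : ∫⁻ z, (1 - ∫⁻ y, f y z ∂μ) ∂ν = 1 - ∫⁻ y, ∫⁻ z, f y z ∂ν ∂μ := by
    rw [lintegral_one_sub ν _ h2 hc, lintegral_lintegral_swap hf.aemeasurable]
  have ha : ∫⁻ y, (1 - ∫⁻ z, f y z ∂ν) ∂μ = 1 - ∫⁻ y, ∫⁻ z, f y z ∂ν ∂μ :=
    lintegral_one_sub μ _ h1 hr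
  have hm := measurable_corrDens μ ν f hf
  rw [lintegral_withDensity_eq_lintegral_mul _ hm hd,
    lintegral_prod _ (hm.mul hd).aemeasurable]
  set R := 1 - ∫⁻ y, ∫⁻ z, f y z ∂ν ∂μ with hR
  calc _ ≤ ∫⁻ y, ∫⁻ z, (f y z * d (y, z) +
        (1 - ∫⁻ z, f y z ∂ν) * (1 - ∫⁻ y, f y z ∂μ) * (R⁻¹ * C)) ∂ν ∂μ := by
        gcongr with y z
        simp only [Pi.mul_apply, corrDens]
        rw [add_mul, mul_assoc _ _ (d (y, z))]
        gcongr
        exact hC _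
    _ = ∫⁻ y, (∫⁻ z, f y z * d (y, z) ∂ν + (1 - ∫⁻ z, f y z ∂ν) * (R * (R⁻¹ * C))) ∂μ := by
        congr 1
        ext y
        rw [lintegral_add_left]
        · rw [lintegral_mul_const, lintegral_const_mul, hb, mul_assoc]
          · exact measurable_const.sub h2
          · exact (measurable_const.sub h2).const_mul _
        · exact (h3.mul hd).comp measurable_prodMk_left
    _ = ∫⁻ y, ∫⁻ z, f y z * d (y, z) ∂ν ∂μ + R * (R * (R⁻¹ * C)) := by
        rw [lintegral_add_left, lintegral_mul_const, ha]
        · exact measurable_const.sub h1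
        · exact (h3.mul hd).lintegral_prod_right'
    _ ≤ _ := by
        refine add_le_add le_rfl ?_
        calc R * (R * (R⁻¹ * C)) = (R * R⁻¹) * (C * R) := by ring
          _ ≤ 1 * (C * R) := by gcongr; exact ENNReal.mul_inv_le_one R
          _ = _ := one_mul _

/-- countable family of finitely supported matrices -/
noncomputable def fam (s : Finset (ℕ × ℕ × ℚ)) (i j : ℕ) : ℝ≥0∞ :=
  s.sup fun p => if p.1 = i ∧ p.2.1 = j then (((p.2.2 : ℝ).toNNReal : NNReal) : ℝ≥0∞) else 0

lemma fam_le (t : ℕ → ℕ → ℝ≥0∞) (s : Finset (ℕ × ℕ × ℚ))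
    (hs : ∀ p ∈ s, (((p.2.2 : ℝ).toNNReal : NNReal) : ℝ≥0∞) ≤ t p.1 p.2.1) (i j : ℕ) :
    fam s i j ≤ t i j := by
  unfold fam
  refine Finset.sup_le fun p hp => ?_
  split_ifs with h
  · rw [← h.1, ← h.2]; exact hs p hp
  · exact zero_le

lemma fam_mono {s s' : Finset (ℕ × ℕ × ℚ)} (h : s ⊆ s') (i j : ℕ) : fam s i j ≤ fam s' i j :=
  Finset.sup_mono h

lemma iSup_fam (t : ℕ → ℕ → ℝ≥0∞) (i j : ℕ) :
    ⨆ s : {s : Finset (ℕ × ℕ × ℚ) //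
      ∀ p ∈ s, (((p.2.2 : ℝ).toNNReal : NNReal) : ℝ≥0∞) ≤ t p.1 p.2.1}, fam s.1 i j = t i j := by
  refine le_antisymm (iSup_le fun s => fam_le t s.1 s.2 i j) ?_
  refine le_of_forall_lt fun c hc => ?_
  obtain ⟨q, -, h1, h2⟩ := ENNReal.lt_iff_exists_rat_btwn.1 hc
  refine lt_of_lt_of_le h1 ?_
  refine le_iSup_of_le ⟨{(i, j, q)}, ?_⟩ ?_
  · intro p hp
    rw [Finset.mem_singleton] at hp
    subst hp
    exact h2.le
  · simp [fam]

/-- Exhausting a matrix by members of the family. -/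
lemma exists_fam {Y : Type*} [MeasurableSpace Y] (μ : Measure Y) (k l : Y → ℕ)
    (hk : Measurable k) (hl : Measurable l)
    (t : ℕ → ℕ → ℝ≥0∞) (c : ℝ≥0∞) (hc : c < ∫⁻ y, t (k y) (l y) ∂μ) :
    ∃ s : Finset (ℕ × ℕ × ℚ), (∀ i j, fam s i j ≤ t i j) ∧
      c < ∫⁻ y, fam s (k y) (l y) ∂μ := by
  have hmeas : ∀ r : ℕ → ℕ → ℝ≥0∞, Measurable (fun y => r (k y) (l y)) := fun r =>
    (measurable_of_countable (fun p : ℕ × ℕ => r p.1 p.2)).comp (hk.prodMk hl)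
  simp_rw [← iSup_fam t] at hc
  rw [lintegral_iSup_directed (f := fun (s : {s : Finset (ℕ × ℕ × ℚ) //
      ∀ p ∈ s, (((p.2.2 : ℝ).toNNReal : NNReal) : ℝ≥0∞) ≤ t p.1 p.2.1}) y => fam s.1 (k y) (l y))
      (fun s => (hmeas (fam s.1)).aemeasurable)] at hc
  · obtain ⟨s, hs⟩ := lt_iSup_iff.1 hc
    exact ⟨s.1, fam_le t s.1 s.2, hs⟩
  · intro s s'
    refine ⟨⟨s.1 ∪ s'.1, ?_⟩, ?_, ?_⟩
    · intro p hp
      rcases Finset.mem_union.1 hp with h | h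
      · exact s.2 p h
      · exact s'.2 p h
    · intro y; exact fam_mono Finset.subset_union_left _ _
    · intro y; exact fam_mono Finset.subset_union_right _ _

lemma exists_idx {Z : Type*} [MetricSpace Z] [SecondCountableTopology Z] [Nonempty Z]
    [MeasurableSpace Z] [BorelSpace Z] (δ : ℝ≥0∞) (hδ : δ ≠ 0) :
    ∃ (e : ℕ → Z) (idx : Z → ℕ), Measurable idx ∧ ∀ z, edist z (e (idx z)) ≤ δ := by
  classical
  obtain ⟨e, he⟩ := TopologicalSpace.exists_dense_seq Z
  have hex : ∀ z, ∃ n, edist z (e n) < δ := by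
    intro z
    obtain ⟨y, ⟨n, rfl⟩, hy⟩ := EMetric.mem_closure_iff.1 (he z) δ (pos_iff_ne_zero.2 hδ)
    exact ⟨n, hy⟩
  refine ⟨e, fun z => Nat.find (hex z), ?_, fun z => (Nat.find_spec (hex z)).le⟩
  refine measurable_find hex fun n => ?_
  exact measurableSet_lt (measurable_id.edist measurable_const) measurable_const

/-- the density matrix of a discretized coupling -/
noncomputable def tmat {Z : Type*} [MeasurableSpace Z] (μ ν : Measure Z) (γ : Measure (Z × Z))
    (idx : Z → ℕ) (i j : ℕ) : ℝ≥0∞ :=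
  γ ((idx ⁻¹' {i}) ×ˢ (idx ⁻¹' {j})) * (μ (idx ⁻¹' {i}))⁻¹ * (ν (idx ⁻¹' {j}))⁻¹

lemma tmat_mul {Z : Type*} [MeasurableSpace Z] (μ ν : Measure Z) [IsProbabilityMeasure μ]
    [IsProbabilityMeasure ν] (γ : Measure (Z × Z)) (h1 : γ.map Prod.fst = μ)
    (h2 : γ.map Prod.snd = ν) (idx : Z → ℕ) (hidx : Measurable idx)
    (i j : ℕ) : tmat μ ν γ idx i j * (ν (idx ⁻¹' {j})) =
    γ ((idx ⁻¹' {i}) ×ˢ (idx ⁻¹' {j})) * (μ (idx ⁻¹' {i}))⁻¹ := by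
  unfold tmat
  by_cases h : ν (idx ⁻¹' {j}) = 0
  · have : γ ((idx ⁻¹' {i}) ×ˢ (idx ⁻¹' {j})) = 0 := by
      rw [← h2, Measure.map_apply measurable_snd (hidx (measurableSet_singleton j))] at h
      exact measure_mono_null (fun p hp => hp.2) h
    simp [this]
  · rw [mul_assoc _ _ (ν _), ENNReal.inv_mul_cancel h (measure_ne_top _ _), mul_one]

lemma tmat_mul_left {Z : Type*} [MeasurableSpace Z] (μ ν : Measure Z) [IsProbabilityMeasure μ]
    [IsProbabilityMeasure ν] (γ : Measure (Z × Z)) (h1 : γ.map Prod.fst = μ)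
    (h2 : γ.map Prod.snd = ν) (idx : Z → ℕ) (hidx : Measurable idx)
    (i j : ℕ) : tmat μ ν γ idx i j * (μ (idx ⁻¹' {i})) =
    γ ((idx ⁻¹' {i}) ×ˢ (idx ⁻¹' {j})) * (ν (idx ⁻¹' {j}))⁻¹ := by
  unfold tmat
  by_cases h : μ (idx ⁻¹' {i}) = 0
  · have : γ ((idx ⁻¹' {i}) ×ˢ (idx ⁻¹' {j})) = 0 := by
      rw [← h1, Measure.map_apply measurable_fst (hidx (measurableSet_singleton i))] at h
      exact measure_mono_null (fun p hp => hp.1) h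
    simp [this]
  · rw [mul_right_comm, mul_assoc _ _ (μ _), ENNReal.inv_mul_cancel h (measure_ne_top _ _), mul_one]

lemma tmat_mul_mul {Z : Type*} [MeasurableSpace Z] (μ ν : Measure Z) [IsProbabilityMeasure μ]
    [IsProbabilityMeasure ν] (γ : Measure (Z × Z)) (h1 : γ.map Prod.fst = μ)
    (h2 : γ.map Prod.snd = ν) (idx : Z → ℕ) (hidx : Measurable idx)
    (i j : ℕ) : tmat μ ν γ idx i j * (ν (idx ⁻¹' {j})) * (μ (idx ⁻¹' {i})) =
    γ ((idx ⁻¹' {i}) ×ˢ (idx ⁻¹' {j})) := by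
  rw [tmat_mul μ ν γ h1 h2 idx hidx]
  by_cases h : μ (idx ⁻¹' {i}) = 0
  · have : γ ((idx ⁻¹' {i}) ×ˢ (idx ⁻¹' {j})) = 0 := by
      rw [← h1, Measure.map_apply measurable_fst (hidx (measurableSet_singleton i))] at h
      exact measure_mono_null (fun p hp => hp.1) h
    simp [this]
  · rw [mul_assoc _ _ (μ _), ENNReal.inv_mul_cancel h (measure_ne_top _ _), mul_one]

lemma lintegral_idx {Z : Type*} [MeasurableSpace Z] (μ : Measure Z) (idx : Z → ℕ)
    (hidx : Measurable idx) (h : ℕ → ℝ≥0∞) : ∫⁻ z, h (idx z) ∂μ = ∑' j, h j * μ (idx ⁻¹' {j}) := by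
  rw [← lintegral_map (μ := μ) (measurable_of_countable h) hidx, lintegral_countable']
  congr 1; ext j
  rw [Measure.map_apply hidx (measurableSet_singleton j)]

lemma tmat_row {Z : Type*} [MeasurableSpace Z] (μ ν : Measure Z) [IsProbabilityMeasure μ]
    [IsProbabilityMeasure ν] (γ : Measure (Z × Z)) (h1 : γ.map Prod.fst = μ)
    (h2 : γ.map Prod.snd = ν) (idx : Z → ℕ) (hidx : Measurable idx)
    (i : ℕ) : ∫⁻ z, tmat μ ν γ idx i (idx z) ∂ν ≤ 1 := by
  rw [lintegral_idx ν idx hidx]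
  simp_rw [tmat_mul μ ν γ h1 h2 idx hidx]
  rw [ENNReal.tsum_mul_right, ← measure_iUnion]
  · rw [← Set.prod_iUnion]
    refine le_trans (mul_le_mul_left (?_ : _ ≤ μ (idx ⁻¹' {i})) _) (ENNReal.mul_inv_le_one _)
    rw [← h1, Measure.map_apply measurable_fst (hidx (measurableSet_singleton i))]
    exact measure_mono fun p hp => hp.1
  · intro j j' hj
    refine Set.disjoint_left.2 fun p hp hp' => hj ?_
    exact hp.2.symm.trans hp'.2
  · exact fun j => (hidx (measurableSet_singleton i)).prod (hidx (measurableSet_singleton j))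

lemma tmat_col {Z : Type*} [MeasurableSpace Z] (μ ν : Measure Z) [IsProbabilityMeasure μ]
    [IsProbabilityMeasure ν] (γ : Measure (Z × Z)) (h1 : γ.map Prod.fst = μ)
    (h2 : γ.map Prod.snd = ν) (idx : Z → ℕ) (hidx : Measurable idx)
    (j : ℕ) : ∫⁻ y, tmat μ ν γ idx (idx y) j ∂μ ≤ 1 := by
  rw [lintegral_idx μ idx hidx (fun i => tmat μ ν γ idx i j)]
  simp_rw [tmat_mul_left μ ν γ h1 h2 idx hidx]
  rw [ENNReal.tsum_mul_right, ← measure_iUnion]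
  · rw [← Set.iUnion_prod_const]
    refine le_trans (mul_le_mul_left (?_ : _ ≤ ν (idx ⁻¹' {j})) _) (ENNReal.mul_inv_le_one _)
    rw [← h2, Measure.map_apply measurable_snd (hidx (measurableSet_singleton j))]
    exact measure_mono fun p hp => hp.2
  · intro i i' hi
    refine Set.disjoint_left.2 fun p hp hp' => hi ?_
    exact hp.1.symm.trans hp'.1
  · exact fun i => (hidx (measurableSet_singleton i)).prod (hidx (measurableSet_singleton j))

lemma tmat_lintegral {Z : Type*} [MeasurableSpace Z] (μ ν : Measure Z) [IsProbabilityMeasure μ]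
    [IsProbabilityMeasure ν] (γ : Measure (Z × Z)) (h1 : γ.map Prod.fst = μ)
    (h2 : γ.map Prod.snd = ν) (idx : Z → ℕ) (hidx : Measurable idx)
    (H : ℕ → ℕ → ℝ≥0∞) :
    ∫⁻ y, ∫⁻ z, tmat μ ν γ idx (idx y) (idx z) * H (idx y) (idx z) ∂ν ∂μ =
      ∫⁻ p, H (idx p.1) (idx p.2) ∂γ := by
  have e1 : ∀ y, ∫⁻ z, tmat μ ν γ idx (idx y) (idx z) * H (idx y) (idx z) ∂ν =
      ∑' j, tmat μ ν γ idx (idx y) j * H (idx y) j * ν (idx ⁻¹' {j}) := fun y =>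
    lintegral_idx ν idx hidx (fun j => tmat μ ν γ idx (idx y) j * H (idx y) j)
  simp_rw [e1]
  rw [lintegral_idx μ idx hidx
    (fun i => ∑' j, tmat μ ν γ idx i j * H i j * ν (idx ⁻¹' {j}))]
  have hm : Measurable (fun p : Z × Z => (idx p.1, idx p.2)) :=
    (hidx.comp measurable_fst).prodMk (hidx.comp measurable_snd)
  rw [← lintegral_map (μ := γ) (f := fun q : ℕ × ℕ => H q.1 q.2) (measurable_of_countable _) hm,
    lintegral_countable', ENNReal.tsum_prod']
  congr 1; ext i
  rw [← ENNReal.tsum_mul_right]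
  congr 1; ext j
  rw [Measure.map_apply hm (measurableSet_singleton _)]
  have : (fun p : Z × Z => (idx p.1, idx p.2)) ⁻¹' {(i, j)} = (idx ⁻¹' {i}) ×ˢ (idx ⁻¹' {j}) := by
    ext p; simp
  rw [this, ← tmat_mul_mul μ ν γ h1 h2 idx hidx]
  ring

/-- feasibility and cost of a family member -/
lemma exists_good {Z : Type*} [MetricSpace Z] [SecondCountableTopology Z]
    [MeasurableSpace Z] [BorelSpace Z] (μ ν : Measure Z) [IsProbabilityMeasure μ]
    [IsProbabilityMeasure ν] (γ : Measure (Z × Z)) [IsProbabilityMeasure γ]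
    (h1 : γ.map Prod.fst = μ) (h2 : γ.map Prod.snd = ν) (δ : ℝ≥0∞) (hδ : δ ≠ 0)
    (e : ℕ → Z) (idx : Z → ℕ) (hidx : Measurable idx) (he : ∀ z, edist z (e (idx z)) ≤ δ)
    (C : ℝ≥0∞) :
    ∃ s : Finset (ℕ × ℕ × ℚ), (∀ i, ∫⁻ z, fam s i (idx z) ∂ν ≤ 1) ∧
      (∀ j, ∫⁻ y, fam s (idx y) j ∂μ ≤ 1) ∧
      ∫⁻ y, ∫⁻ z, fam s (idx y) (idx z) * edist y z ∂ν ∂μ +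
        C * (1 - ∫⁻ y, ∫⁻ z, fam s (idx y) (idx z) ∂ν ∂μ) ≤
      ∫⁻ p, edist p.1 p.2 ∂γ + (4 + C) * δ := by
  have hmeas : ∀ r : ℕ → ℕ → ℝ≥0∞, Measurable (fun p : Z × Z => r (idx p.1) (idx p.2)) := fun r =>
    (measurable_of_countable (fun p : ℕ × ℕ => r p.1 p.2)).comp
      ((hidx.comp measurable_fst).prodMk (hidx.comp measurable_snd))
  have htot : ∫⁻ p, tmat μ ν γ idx (idx p.1) (idx p.2) ∂(μ.prod ν) = 1 := by
    rw [lintegral_prod _ (hmeas _).aemeasurable]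
    have := tmat_lintegral μ ν γ h1 h2 idx hidx (fun _ _ => 1)
    simpa using this
  obtain ⟨s, hs, hlt⟩ := exists_fam (μ.prod ν) (fun p => idx p.1) (fun p => idx p.2)
    (hidx.comp measurable_fst) (hidx.comp measurable_snd) (tmat μ ν γ idx) (1 - δ) (by
      rw [htot]; exact ENNReal.sub_lt_self (by simp) (by simp) hδ)
  rw [lintegral_prod _ (hmeas _).aemeasurable] at hlt
  refine ⟨s, fun i => (lintegral_mono fun z => hs _ _).trans (tmat_row μ ν γ h1 h2 idx hidx i),
    fun i => (lintegral_mono fun z => hs _ _).trans (tmat_col μ ν γ h1 h2 idx hidx i), ?_⟩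
  have hD : ∀ y z, edist y z ≤ edist (e (idx y)) (e (idx z)) + 2 * δ := by
    intro y z
    calc edist y z ≤ edist y (e (idx y)) + edist (e (idx y)) (e (idx z)) + edist (e (idx z)) z :=
          edist_triangle4 _ _ _ _
      _ ≤ δ + edist (e (idx y)) (e (idx z)) + δ := by
          gcongr
          · exact he y
          · rw [edist_comm]; exact he z
      _ = _ := by ring
  have hD' : ∀ y z, edist (e (idx y)) (e (idx z)) ≤ edist y z + 2 * δ := by
    intro y z
    calc edist (e (idx y)) (e (idx z)) ≤ edist (e (idx y)) y + edist y z + edist z (e (idx z)) :=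
          edist_triangle4 _ _ _ _
      _ ≤ δ + edist y z + δ := by
          gcongr
          · rw [edist_comm]; exact he y
          · exact he z
      _ = _ := by ring
  calc _ ≤ ∫⁻ y, ∫⁻ z, tmat μ ν γ idx (idx y) (idx z) *
          (edist (e (idx y)) (e (idx z)) + 2 * δ) ∂ν ∂μ + C * δ := by
        gcongr with y z
        · exact hs _ _
        · exact hD y z
        · rw [tsub_le_iff_left]
          exact tsub_le_iff_right.1 hlt.le
    _ = ∫⁻ p, (edist (e (idx p.1)) (e (idx p.2)) + 2 * δ) ∂γ + C * δ := by
        rw [tmat_lintegral μ ν γ h1 h2 idx hidx (fun i j => edist (e i) (e j) + 2 * δ)]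
    _ ≤ ∫⁻ p, (edist p.1 p.2 + 2 * δ + 2 * δ) ∂γ + C * δ := by
        gcongr with p; exact hD' _ _
    _ = _ := by
        rw [lintegral_add_right _ measurable_const, lintegral_add_right _ measurable_const]
        simp only [lintegral_const, measure_univ, mul_one]
        ring

lemma exists_coupling_kernel {X Z : Type*} [MeasurableSpace X] [MetricSpace Z]
    [SecondCountableTopology Z] [Nonempty Z]
    [MeasurableSpace Z] [BorelSpace Z] (μ ν : Kernel X Z) [IsMarkovKernel μ] [IsMarkovKernel ν]
    (C : ℝ≥0∞) (hCtop : C ≠ ∞) (hC : ∀ y z : Z, edist y z ≤ C) (ε : ℝ≥0∞) (hε : ε ≠ 0) :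
    ∃ Γ : Kernel X (Z × Z), IsMarkovKernel Γ ∧ (∀ x, (Γ x).map Prod.fst = μ x) ∧
      (∀ x, (Γ x).map Prod.snd = ν x) ∧
      ∀ x, ∫⁻ p, edist p.1 p.2 ∂(Γ x) ≤ wasserstein dist (μ x) (ν x) + (ε + ε) := by
  classical
  have h4C : (4 + C) ≠ ∞ := by simp [hCtop]
  have h4C0 : (4 + C) ≠ 0 := by simp
  have hδ : ε * (4 + C)⁻¹ ≠ 0 := mul_ne_zero hε (ENNReal.inv_ne_zero.2 h4C)
  obtain ⟨e, idx, hidx, he⟩ := exists_idx (Z := Z) (ε * (4 + C)⁻¹) hδ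
  obtain ⟨enum, henum⟩ := exists_surjective_nat (Finset (ℕ × ℕ × ℚ))
  have hmeas : ∀ r : ℕ → ℕ → ℝ≥0∞, Measurable (fun p : Z × Z => r (idx p.1) (idx p.2)) := fun r =>
    (measurable_of_countable (fun p : ℕ × ℕ => r p.1 p.2)).comp
      ((hidx.comp measurable_fst).prodMk (hidx.comp measurable_snd))
  have hprod : ∀ h : Z × Z → ℝ≥0∞, Measurable h →
      Measurable (fun x => ∫⁻ y, ∫⁻ z, h (y, z) ∂(ν x) ∂(μ x)) := by
    intro h hh
    have : (fun x => ∫⁻ y, ∫⁻ z, h (y, z) ∂(ν x) ∂(μ x)) = fun x => ∫⁻ p, h p ∂((μ ×ₖ ν) x) := by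
      ext x
      rw [Kernel.prod_apply, lintegral_prod _ hh.aemeasurable]
    rw [this]
    exact hh.lintegral_kernel
  have hrow : ∀ n i, Measurable (fun x => ∫⁻ z, fam (enum n) i (idx z) ∂(ν x)) := fun n i =>
    ((measurable_of_countable (fam (enum n) i)).comp hidx).lintegral_kernel
  have hcol : ∀ n j, Measurable (fun x => ∫⁻ y, fam (enum n) (idx y) j ∂(μ x)) := fun n j =>
    ((measurable_of_countable (fun i => fam (enum n) i j)).comp hidx).lintegral_kernel
  let feas : ℕ → X → Prop := fun n x => (∀ i, ∫⁻ z, fam (enum n) i (idx z) ∂(ν x) ≤ 1) ∧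
      (∀ j, ∫⁻ y, fam (enum n) (idx y) j ∂(μ x) ≤ 1)
  have hfeas : ∀ n, MeasurableSet {x | feas n x} := by
    intro n
    refine MeasurableSet.inter (s₁ := {x | ∀ i, ∫⁻ z, fam (enum n) i (idx z) ∂(ν x) ≤ 1})
      (s₂ := {x | ∀ j, ∫⁻ y, fam (enum n) (idx y) j ∂(μ x) ≤ 1}) ?_ ?_
    · rw [Set.ofPred_forall]
      exact MeasurableSet.iInter fun i => measurableSet_le (hrow n i) measurable_const
    · rw [Set.ofPred_forall]
      exact MeasurableSet.iInter fun i => measurableSet_le (hcol n i) measurable_const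
  let cost : ℕ → X → ℝ≥0∞ := fun n x =>
    ∫⁻ y, ∫⁻ z, fam (enum n) (idx y) (idx z) * edist y z ∂(ν x) ∂(μ x) +
        C * (1 - ∫⁻ y, ∫⁻ z, fam (enum n) (idx y) (idx z) ∂(ν x) ∂(μ x))
  have hcost : ∀ n, Measurable (cost n) := by
    intro n
    refine Measurable.add ?_ (Measurable.const_mul (measurable_const.sub ?_) _)
    · exact hprod (fun p => fam (enum n) (idx p.1) (idx p.2) * edist p.1 p.2)
        ((hmeas _).mul measurable_edist)
    · exact hprod (fun p => fam (enum n) (idx p.1) (idx p.2)) (hmeas _)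
  let F : ℕ → X → ℝ≥0∞ := fun n x => if feas n x then cost n x else ∞
  have hF : ∀ n, Measurable (F n) := fun n => Measurable.ite (hfeas n) (hcost n) measurable_const
  have hI : Measurable (fun x => ⨅ n, F n x) := Measurable.iInf hF
  have hItop : ∀ x, ⨅ n, F n x ≠ ∞ := by
    intro x
    obtain ⟨n, hn⟩ := henum ∅
    refine ne_top_of_le_ne_top hCtop (iInf_le_of_le n ?_)
    simp [F, feas, cost, hn, fam]
  have hex : ∀ x, ∃ n, F n x < (⨅ n, F n x) + ε := fun x =>
    iInf_lt_iff.1 (ENNReal.lt_add_right (hItop x) hε)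
  let N : X → ℕ := fun x => Nat.find (hex x)
  have hN : Measurable N := measurable_find hex fun n =>
    measurableSet_lt (hF n) (hI.add measurable_const)
  have hNs : ∀ x, F (N x) x < (⨅ n, F n x) + ε := fun x => Nat.find_spec (hex x)
  have hNf : ∀ x, feas (N x) x := by
    intro x
    by_contra h
    have := hNs x
    simp only [F, if_neg h] at this
    exact not_top_lt this
  have hNc : ∀ x, cost (N x) x ≤ (⨅ n, F n x) + ε := by
    intro x
    have := (hNs x).le
    simpa only [F, if_pos (hNf x)] using this
  have hIW : ∀ x, ⨅ n, F n x ≤ wasserstein dist (μ x) (ν x) + ε := by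
    intro x
    unfold wasserstein
    rw [ENNReal.iInf_add]
    refine le_iInf fun γ => ?_
    by_cases hγ : γ ∈ {γ : Measure (Z × Z) |
      IsProbabilityMeasure γ ∧ γ.map Prod.fst = μ x ∧ γ.map Prod.snd = ν x}
    · rw [iInf_pos hγ]
      obtain ⟨hp, h1, h2⟩ := hγ
      obtain ⟨s, hs1, hs2, hs3⟩ := exists_good (μ x) (ν x) γ h1 h2 _ hδ e idx hidx he C
      obtain ⟨n, hn⟩ := henum s
      subst hn
      refine iInf_le_of_le n ?_
      have hf : feas n x := ⟨hs1, hs2⟩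
      simp only [F, if_pos hf, cost]
      refine hs3.trans ?_
      rw [mul_left_comm, ENNReal.mul_inv_cancel h4C0 h4C, mul_one]
      simp only [edist_dist]
      exact le_rfl
    · rw [iInf_neg hγ]; simp
  have hg : Measurable (Function.uncurry fun (x : X) (p : Z × Z) =>
      corrDens (μ x) (ν x) (fun y z => fam (enum (N x)) (idx y) (idx z)) p) := by
    have key : Measurable (fun q : (X × (Z × Z)) × ℕ => corrDens (μ q.1.1) (ν q.1.1)
        (fun y z => fam (enum q.2) (idx y) (idx z)) q.1.2) := by
      refine measurable_from_prod_countable_left fun n => ?_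
      unfold corrDens
      have a1 : Measurable (fun q : X × (Z × Z) => fam (enum n) (idx q.2.1) (idx q.2.2)) :=
        (hmeas (fam (enum n))).comp measurable_snd
      have a2 : Measurable (fun q : X × (Z × Z) =>
          ∫⁻ z, fam (enum n) (idx q.2.1) (idx z) ∂(ν q.1)) := by
        have : Measurable (fun r : X × ℕ => ∫⁻ z, fam (enum n) r.2 (idx z) ∂(ν r.1)) :=
          measurable_from_prod_countable_left fun i => hrow n i
        exact this.comp (measurable_fst.prodMk (hidx.comp (measurable_fst.comp measurable_snd)))
      have a3 : Measurable (fun q : X × (Z × Z) =>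
          ∫⁻ y, fam (enum n) (idx y) (idx q.2.2) ∂(μ q.1)) := by
        have : Measurable (fun r : X × ℕ => ∫⁻ y, fam (enum n) (idx y) r.2 ∂(μ r.1)) :=
          measurable_from_prod_countable_left fun i => hcol n i
        exact this.comp (measurable_fst.prodMk (hidx.comp (measurable_snd.comp measurable_snd)))
      have a4 : Measurable (fun q : X × (Z × Z) =>
          ∫⁻ y, ∫⁻ z, fam (enum n) (idx y) (idx z) ∂(ν q.1) ∂(μ q.1)) :=
        (hprod (fun p => fam (enum n) (idx p.1) (idx p.2)) (hmeas _)).comp measurable_fst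
      exact a1.add (((measurable_const.sub a2).mul (measurable_const.sub a3)).mul
        (measurable_const.sub a4).inv)
    exact key.comp (measurable_id.prodMk (hN.comp measurable_fst))
  let Γ : Kernel X (Z × Z) := Kernel.withDensity (μ ×ₖ ν) (fun (x : X) (p : Z × Z) =>
      corrDens (μ x) (ν x) (fun y z => fam (enum (N x)) (idx y) (idx z)) p)
  have hΓ : ∀ x, Γ x = ((μ x).prod (ν x)).withDensity
      (corrDens (μ x) (ν x) (fun y z => fam (enum (N x)) (idx y) (idx z))) := by
    intro x
    simp only [Γ]
    rw [Kernel.withDensity_apply _ hg, Kernel.prod_apply]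
  have hfst : ∀ x, (Γ x).map Prod.fst = μ x := by
    intro x
    rw [hΓ]
    refine withDensity_fst _ _ _ (measurable_corrDens _ _ _ (hmeas _)) ?_
    exact corrDens_row _ _ _ (hmeas _) (fun y => (hNf x).1 _) (fun z => (hNf x).2 _)
  have hsnd : ∀ x, (Γ x).map Prod.snd = ν x := by
    intro x
    rw [hΓ]
    refine withDensity_snd _ _ _ (measurable_corrDens _ _ _ (hmeas _)) ?_
    simp_rw [corrDens_swap (μ x) (ν x) (fun y z => fam (enum (N x)) (idx y) (idx z)) (hmeas _)]
    exact corrDens_row _ _ _ (hmeas fun i j => fam (enum (N x)) j i)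
      (fun y => (hNf x).2 _) (fun z => (hNf x).1 _)
  refine ⟨Γ, ⟨fun x => ⟨?_⟩⟩, hfst, hsnd, fun x => ?_⟩
  · have := congrArg (fun m => m Set.univ) (hfst x)
    simpa [Measure.map_apply measurable_fst MeasurableSet.univ] using this
  · rw [hΓ]
    refine (corrDens_cost _ _ _ (hmeas _) (fun y => (hNf x).1 _) (fun z => (hNf x).2 _)
      (fun p => edist p.1 p.2) measurable_edist C (fun p => hC _ _)).trans ?_
    refine (hNc x).trans ?_
    rw [← add_assoc]
    gcongr
    exact hIW x

lemma exists_glue {E : Type*} [MeasurableSpace E] [StandardBorelSpace E] [Nonempty E]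
    (d : E → E → ℝ≥0∞) (hd : Measurable (Function.uncurry d)) (hsymm : ∀ u v, d u v = d v u)
    (htri : ∀ u v w, d u w ≤ d u v + d v w)
    (Q η χ : Measure E) (Θ γ : Measure (E × E)) [IsProbabilityMeasure Θ] [IsProbabilityMeasure γ]
    (hΘ1 : Θ.map Prod.fst = Q) (hΘ2 : Θ.map Prod.snd = η)
    (hγ1 : γ.map Prod.fst = χ) (hγ2 : γ.map Prod.snd = η) :
    ∃ ρ : Measure (E × E), IsProbabilityMeasure ρ ∧ ρ.map Prod.fst = Q ∧ ρ.map Prod.snd = χ ∧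
      ∫⁻ p, d p.1 p.2 ∂ρ ≤ ∫⁻ p, d p.1 p.2 ∂γ + ∫⁻ p, d p.1 p.2 ∂Θ := by
  have : IsProbabilityMeasure η := by
    rw [← hΘ2]; exact Measure.isProbabilityMeasure_map measurable_snd.aemeasurable
  have i1 : IsProbabilityMeasure (Θ.map Prod.swap) :=
    Measure.isProbabilityMeasure_map measurable_swap.aemeasurable
  have i2 : IsProbabilityMeasure (γ.map Prod.swap) :=
    Measure.isProbabilityMeasure_map measurable_swap.aemeasurable
  have f1 : (Θ.map Prod.swap).fst = η := by
    rw [Measure.fst, Measure.map_map measurable_fst measurable_swap, ← hΘ2]; rfl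
  have f2 : (γ.map Prod.swap).fst = η := by
    rw [Measure.fst, Measure.map_map measurable_fst measurable_swap, ← hγ2]; rfl
  set K1 := (Θ.map Prod.swap).condKernel with hK1
  set K2 := (γ.map Prod.swap).condKernel with hK2
  let ρ' : Measure (E × E × E) := η ⊗ₘ (K1 ×ₖ K2)
  have key1 : ∀ h : E × E → ℝ≥0∞, Measurable h →
      ∫⁻ p, h (p.1, p.2.1) ∂ρ' = ∫⁻ p, h (p.2, p.1) ∂Θ := by
    intro h hh
    have m1 : Measurable (fun p : E × E × E => h (p.1, p.2.1)) := by fun_prop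
    rw [Measure.lintegral_compProd m1]
    have : ∫⁻ p, h (p.2, p.1) ∂Θ = ∫⁻ p, h p ∂(Θ.map Prod.swap) := by
      rw [lintegral_map hh measurable_swap]; rfl
    rw [this, ← Measure.lintegral_condKernel hh, f1]
    congr 1; ext a
    have m2 : Measurable (fun p : E × E => h (a, p.1)) := by fun_prop
    rw [Kernel.prod_apply, lintegral_prod _ m2.aemeasurable]
    simp [hK1]
  have key2 : ∀ h : E × E → ℝ≥0∞, Measurable h →
      ∫⁻ p, h (p.1, p.2.2) ∂ρ' = ∫⁻ p, h (p.2, p.1) ∂γ := by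
    intro h hh
    have m1 : Measurable (fun p : E × E × E => h (p.1, p.2.2)) := by fun_prop
    rw [Measure.lintegral_compProd m1]
    have : ∫⁻ p, h (p.2, p.1) ∂γ = ∫⁻ p, h p ∂(γ.map Prod.swap) := by
      rw [lintegral_map hh measurable_swap]; rfl
    rw [this, ← Measure.lintegral_condKernel hh, f2]
    congr 1; ext a
    have m2 : Measurable (fun p : E × E => h (a, p.2)) := by fun_prop
    rw [Kernel.prod_apply, lintegral_prod _ m2.aemeasurable]
    simp [hK2]
  refine ⟨ρ'.map Prod.snd, Measure.isProbabilityMeasure_map measurable_snd.aemeasurable,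
    ?_, ?_, ?_⟩
  · refine Measure.ext_of_lintegral _ fun h hh => ?_
    rw [lintegral_map hh measurable_fst, lintegral_map (f := fun a : E × E => h a.1) (hh.comp measurable_fst) measurable_snd,
      ← hΘ1, lintegral_map hh measurable_fst]
    exact key1 (fun p => h p.2) (hh.comp measurable_snd)
  · refine Measure.ext_of_lintegral _ fun h hh => ?_
    rw [lintegral_map hh measurable_snd, lintegral_map (f := fun a : E × E => h a.2) (hh.comp measurable_snd) measurable_snd,
      ← hγ1, lintegral_map hh measurable_fst]
    exact key2 (fun p => h p.2) (hh.comp measurable_snd)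
  · have hd' : Measurable (fun p : E × E => d p.1 p.2) := hd
    rw [lintegral_map hd' measurable_snd]
    have m2 : Measurable (fun p : E × E × E => d p.1 p.2.2) :=
      hd'.comp (measurable_fst.prodMk (measurable_snd.comp measurable_snd))
    calc ∫⁻ p, d p.2.1 p.2.2 ∂ρ' ≤ ∫⁻ p, (d p.1 p.2.2 + d p.1 p.2.1) ∂ρ' := by
          gcongr with p
          rw [add_comm, hsymm p.1 p.2.1]; exact htri _ _ _
      _ = ∫⁻ p, d p.1 p.2.2 ∂ρ' + ∫⁻ p, d p.1 p.2.1 ∂ρ' := lintegral_add_left m2 _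
      _ = ∫⁻ p, d p.2 p.1 ∂γ + ∫⁻ p, d p.2 p.1 ∂Θ := by
          rw [key1 (fun p => d p.1 p.2) hd', key2 (fun p => d p.1 p.2) hd']
      _ ≤ _ := by
          refine le_of_eq ?_
          congr 1 <;> (congr 1; ext p; exact hsymm _ _)

lemma lintegral_bind_bind {X B Y E : Type*} [MeasurableSpace X] [MeasurableSpace B]
    [MeasurableSpace Y] [MeasurableSpace E] (ξ : Measure X) (K : Kernel X B) [IsMarkovKernel K]
    (L : Kernel (X × B) Y) [IsMarkovKernel L] (F : (X × B) × Y → E) (hF : Measurable F)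
    (h : E → ℝ≥0∞) (hh : Measurable h) :
    ∫⁻ u, h u ∂(ξ.bind fun a => (K a).bind fun b => (L (a, b)).map fun c => F ((a, b), c)) =
      ∫⁻ a, ∫⁻ b, ∫⁻ c, h (F ((a, b), c)) ∂(L (a, b)) ∂(K a) ∂ξ := by
  have hFx : ∀ x, Measurable (fun c => F (x, c)) := fun x => hF.comp measurable_prodMk_left
  have hM : Measurable (fun x => (L x).map fun c => F (x, c)) := by
    refine Measure.measurable_of_measurable_coe _ fun s hs => ?_
    simp_rw [Measure.map_apply (hFx _) hs]
    exact Kernel.measurable_kernel_prodMk_left (hF hs)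
  have hMa : ∀ a, Measurable (fun b => (L (a, b)).map fun c => F ((a, b), c)) :=
    fun a => hM.comp measurable_prodMk_left
  have hO : Measurable fun a => (K a).bind fun b => (L (a, b)).map fun c => F ((a, b), c) := by
    refine Measure.measurable_of_measurable_coe _ fun s hs => ?_
    simp_rw [Measure.bind_apply hs (hMa _).aemeasurable]
    refine Measurable.lintegral_kernel_prod_right
      (f := fun a b => ((L (a, b)).map fun c => F ((a, b), c)) s) ?_
    exact (Measure.measurable_coe hs).comp hM
  rw [Measure.lintegral_bind hO.aemeasurable hh.aemeasurable]
  congr 1; ext a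
  rw [Measure.lintegral_bind (hMa a).aemeasurable hh.aemeasurable]
  congr 1; ext b
  rw [lintegral_map hh (hFx _)]

/-- **Regularizer upper bound (Lemma 2 of the paper).**
Let `ξ` be the state-action distribution on `S × A`, `φ : S → Z̄` the state
embedding, `κ` the action-encoder kernel, `P` the original transition kernel,
`P̄` the latent transition kernel, and `χ` any distribution over latent
transitions `Z̄ × B̄ × Z̄`.  With `Q` the law of the embedded transition
`(φ s, b, φ s')` and `η` the law of `(φ s, b, z̄')` where `z̄'` is produced by
the latent transition kernel, the Wasserstein distance (for the component-wise
sum metric) between `Q` and `χ` is at most `W(χ, η)` plus the local transition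
loss `L_P`. -/
theorem wasserstein_encoder_le_steadystate_add_transitionLoss
    {S A Zb Bb : Type*}
    [MetricSpace S] [CompleteSpace S] [SecondCountableTopology S]
    [MeasurableSpace S] [BorelSpace S]
    [MeasurableSpace A] [StandardBorelSpace A]
    [MetricSpace Zb] [CompleteSpace Zb] [SecondCountableTopology Zb]
    [MeasurableSpace Zb] [BorelSpace Zb]
    [MetricSpace Bb] [CompleteSpace Bb] [SecondCountableTopology Bb]
    [MeasurableSpace Bb] [BorelSpace Bb]
    (hZbdd : ∃ C, ∀ z w : Zb, dist z w ≤ C)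
    (hBbdd : ∃ C, ∀ b c : Bb, dist b c ≤ C)
    (ξ : Measure (S × A)) [IsProbabilityMeasure ξ]
    (φ : S → Zb) (hφ : Measurable φ)
    (κ : Kernel (Zb × A) Bb) [IsMarkovKernel κ]
    (P : Kernel (S × A) S) [IsMarkovKernel P]
    (Pbar : Kernel (Zb × Bb) Zb) [IsMarkovKernel Pbar]
    (χ : Measure (Zb × Bb × Zb)) [IsProbabilityMeasure χ]
    -- `Q`: law of `(φ s, b, φ s')` with `(s,a) ∼ ξ`, `b ∼ κ(·|φ s, a)`, `s' ∼ P(·|s,a)`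
    (Q : Measure (Zb × Bb × Zb))
    (hQ : Q = ξ.bind (fun sa =>
      (κ (φ sa.1, sa.2)).bind (fun b =>
        (P sa).map (fun s' => (φ sa.1, b, φ s')))))
    -- `η`: law of `(φ s, b, z̄')` with `(s,a) ∼ ξ`, `b ∼ κ(·|φ s, a)`, `z̄' ∼ P̄(·|φ s, b)`
    (η : Measure (Zb × Bb × Zb))
    (hη : η = ξ.bind (fun sa =>
      (κ (φ sa.1, sa.2)).bind (fun b =>
        (Pbar (φ sa.1, b)).map (fun z' => (φ sa.1, b, z'))))) :
    wasserstein
        (fun u v : Zb × Bb × Zb =>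
          dist u.1 v.1 + dist u.2.1 v.2.1 + dist u.2.2 v.2.2) Q χ
      ≤ wasserstein
          (fun u v : Zb × Bb × Zb =>
            dist u.1 v.1 + dist u.2.1 v.2.1 + dist u.2.2 v.2.2) χ η
        + ∫⁻ sa, ∫⁻ b,
            wasserstein dist ((P sa).map φ) (Pbar (φ sa.1, b))
              ∂(κ (φ sa.1, sa.2)) ∂ξ := by
  obtain ⟨CZ, hCZ⟩ := hZbdd
  have hneE : Nonempty (Zb × Bb × Zb) := nonempty_of_isProbabilityMeasure χ
  have hneZ : Nonempty Zb := hneE.map Prod.fst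
  have hCZ' : ∀ y z : Zb, edist y z ≤ ENNReal.ofReal CZ := fun y z => by
    rw [edist_dist]; exact ENNReal.ofReal_le_ofReal (hCZ y z)
  set dd : Zb × Bb × Zb → Zb × Bb × Zb → ℝ := fun u v =>
          dist u.1 v.1 + dist u.2.1 v.2.1 + dist u.2.2 v.2.2 with hdd
  have hddm : Measurable (Function.uncurry fun u v => ENNReal.ofReal (dd u v)) := by
    refine Measurable.ennreal_ofReal ?_
    simp only [hdd]
    refine Measurable.add (Measurable.add ?_ ?_) ?_
    · exact (measurable_fst.comp measurable_fst).dist (measurable_fst.comp measurable_snd)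
    · exact ((measurable_fst.comp measurable_snd).comp measurable_fst).dist
        ((measurable_fst.comp measurable_snd).comp measurable_snd)
    · exact ((measurable_snd.comp measurable_snd).comp measurable_fst).dist
        ((measurable_snd.comp measurable_snd).comp measurable_snd)
  have hdd0 : ∀ u v, 0 ≤ dd u v := fun u v => by simp only [hdd]; positivity
  have hsymm : ∀ u v, ENNReal.ofReal (dd u v) = ENNReal.ofReal (dd v u) := fun u v => by
    simp only [hdd, dist_comm]
  have htri : ∀ u v w, ENNReal.ofReal (dd u w) ≤
      ENNReal.ofReal (dd u v) + ENNReal.ofReal (dd v w) := fun u v w => by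
    rw [← ENNReal.ofReal_add (hdd0 _ _) (hdd0 _ _)]
    refine ENNReal.ofReal_le_ofReal ?_
    simp only [hdd]
    linarith [dist_triangle u.1 v.1 w.1, dist_triangle u.2.1 v.2.1 w.2.1,
      dist_triangle u.2.2 v.2.2 w.2.2]
  -- kernels
  have mκ : Measurable (fun sa : S × A => (φ sa.1, sa.2)) := by fun_prop
  have mP : Measurable (fun x : (S × A) × Bb => (φ x.1.1, x.2)) := by fun_prop
  let κ' : Kernel (S × A) Bb := κ.comap _ mκ
  let L1 : Kernel ((S × A) × Bb) S := P.comap Prod.fst measurable_fst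
  let μ' : Kernel ((S × A) × Bb) Zb := L1.map φ
  let ν' : Kernel ((S × A) × Bb) Zb := Pbar.comap _ mP
  have iμ : IsMarkovKernel μ' := Kernel.IsMarkovKernel.map _ hφ
  have hμ' : ∀ sa b, μ' (sa, b) = (P sa).map φ := fun sa b => by
    simp only [μ', L1]
    rw [Kernel.map_apply _ hφ, Kernel.comap_apply]
  have hQl : ∀ h : Zb × Bb × Zb → ℝ≥0∞, Measurable h → ∫⁻ u, h u ∂Q =
      ∫⁻ sa, ∫⁻ b, ∫⁻ y, h (φ sa.1, b, y) ∂(μ' (sa, b)) ∂(κ' sa) ∂ξ := by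
    intro h hh
    rw [hQ]
    refine (lintegral_bind_bind ξ κ' L1 (fun q => (φ q.1.1.1, q.1.2, φ q.2)) (by fun_prop)
      h hh).trans ?_
    refine lintegral_congr fun sa => lintegral_congr fun b => ?_
    rw [hμ', lintegral_map (by fun_prop) hφ]
    rfl
  have hηl : ∀ h : Zb × Bb × Zb → ℝ≥0∞, Measurable h → ∫⁻ u, h u ∂η =
      ∫⁻ sa, ∫⁻ b, ∫⁻ y, h (φ sa.1, b, y) ∂(ν' (sa, b)) ∂(κ' sa) ∂ξ := by
    intro h hh
    rw [hη]
    exact lintegral_bind_bind ξ κ' ν' (fun q => (φ q.1.1.1, q.1.2, q.2)) (by fun_prop) h hh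
  refine ENNReal.le_of_forall_pos_le_add fun ε hε _ => ?_
  obtain ⟨Γ, hΓM, hΓ1, hΓ2, hΓc⟩ := exists_coupling_kernel μ' ν' (ENNReal.ofReal CZ)
    ENNReal.ofReal_ne_top hCZ' ((ε : ℝ≥0∞) / 2) (by simp [hε.ne'])
  rw [ENNReal.add_halves] at hΓc
  let T : ((S × A) × Bb) × (Zb × Zb) → (Zb × Bb × Zb) × (Zb × Bb × Zb) := fun q =>
    ((φ q.1.1.1, q.1.2, q.2.1), (φ q.1.1.1, q.1.2, q.2.2))
  have hT : Measurable T := by fun_prop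
  let Θ : Measure ((Zb × Bb × Zb) × (Zb × Bb × Zb)) := ((ξ ⊗ₘ κ') ⊗ₘ Γ).map T
  have iΘ : IsProbabilityMeasure Θ := Measure.isProbabilityMeasure_map hT.aemeasurable
  have hΘl : ∀ h : (Zb × Bb × Zb) × (Zb × Bb × Zb) → ℝ≥0∞, Measurable h → ∫⁻ u, h u ∂Θ =
      ∫⁻ sa, ∫⁻ b, ∫⁻ p, h (T ((sa, b), p)) ∂(Γ (sa, b)) ∂(κ' sa) ∂ξ := by
    intro h hh
    have m1 : Measurable fun q => h (T q) := hh.comp hT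
    rw [lintegral_map hh hT, Measure.lintegral_compProd m1, Measure.lintegral_compProd]
    exact Measurable.lintegral_kernel_prod_right (f := fun x p => h (T (x, p))) m1
  have hΘ1 : Θ.map Prod.fst = Q := by
    refine Measure.ext_of_lintegral _ fun h hh => ?_
    rw [lintegral_map hh measurable_fst, hΘl (fun u => h u.1) (hh.comp measurable_fst), hQl h hh]
    refine lintegral_congr fun sa => lintegral_congr fun b => ?_
    rw [← hΓ1, lintegral_map (by fun_prop) measurable_fst]
  have hΘ2 : Θ.map Prod.snd = η := by
    refine Measure.ext_of_lintegral _ fun h hh => ?_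
    rw [lintegral_map hh measurable_snd, hΘl (fun u => h u.2) (hh.comp measurable_snd), hηl h hh]
    refine lintegral_congr fun sa => lintegral_congr fun b => ?_
    rw [← hΓ2, lintegral_map (by fun_prop) measurable_snd]
  have hΘc : ∫⁻ p, ENNReal.ofReal (dd p.1 p.2) ∂Θ ≤ ∫⁻ sa, ∫⁻ b,
            wasserstein dist ((P sa).map φ) (Pbar (φ sa.1, b))
              ∂(κ (φ sa.1, sa.2)) ∂ξ + ε := by
    rw [hΘl (fun p => ENNReal.ofReal (dd p.1 p.2)) hddm]
    calc _ ≤ ∫⁻ sa, ∫⁻ b, (wasserstein dist ((P sa).map φ) (Pbar (φ sa.1, b)) + ε)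
              ∂(κ (φ sa.1, sa.2)) ∂ξ := by
          refine lintegral_mono fun sa => lintegral_mono fun b => ?_
          refine le_trans (le_of_eq ?_) ((hΓc (sa, b)).trans (le_of_eq ?_))
          · refine lintegral_congr fun p => ?_
            simp [hdd, T, edist_dist]
          · rw [hμ']; rfl
      _ = _ := by
          have e1 : ∀ sa : S × A, ∫⁻ b, (wasserstein dist ((P sa).map φ) (Pbar (φ sa.1, b)) + ε)
              ∂(κ (φ sa.1, sa.2)) = ∫⁻ b, wasserstein dist ((P sa).map φ) (Pbar (φ sa.1, b))
              ∂(κ (φ sa.1, sa.2)) + ε := fun sa => by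
            rw [lintegral_add_right _ measurable_const]; simp
          simp_rw [e1]
          rw [lintegral_add_right _ measurable_const]; simp
  rw [add_assoc]
  refine le_trans ?_ (add_le_add le_rfl hΘc)
  conv_rhs => unfold wasserstein
  rw [ENNReal.iInf_add]
  refine le_iInf fun γ => ?_
  by_cases hγ : γ ∈ {γ : Measure ((Zb × Bb × Zb) × (Zb × Bb × Zb)) |
      IsProbabilityMeasure γ ∧ γ.map Prod.fst = χ ∧ γ.map Prod.snd = η}
  · rw [iInf_pos hγ]
    obtain ⟨hp, h1, h2⟩ := hγ
    obtain ⟨ρ, r0, r1, r2, r3⟩ := exists_glue (fun u v => ENNReal.ofReal (dd u v)) hddm hsymm htri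
      Q η χ Θ γ hΘ1 hΘ2 h1 h2
    refine le_trans ?_ r3
    unfold wasserstein
    exact iInf₂_le ρ ⟨r0, r1, r2⟩
  · rw [iInf_neg hγ]; simp
end

section
/- Let (X, d_X) and (Y, d_Y) be Polish metric spaces with bounded metrics, ρ a probability measure on X, and K_1, K_2 Markov kernels from X to Y. For i = 1, 2 let μ_i be the probability measure on X × Y given by μ_i(dx, dy) = ρ(dx) K_i(dy | x), and equip X × Y with the metric d((x,y),(x',y')) = d_X(x,x') + d_Y(y,y'). Then W_d(μ_1, μ_2) ≤ ∫_X W_{d_Y}( K_1(·|x), K_2(·|x) ) dρ(x). -/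
open MeasureTheory ProbabilityTheory ENNReal Filter

/-- A sub-coupling can be completed to a coupling, paying at most `C` per unit missing mass. -/
lemma wass_le_of_subcoupling {Z : Type*} [MeasurableSpace Z] (c : Z → Z → ℝ) (C : ℝ)
    (hc : ∀ z z', c z z' ≤ C) (P Q : Measure Z) [IsProbabilityMeasure P] [IsProbabilityMeasure Q]
    (Γ : Measure (Z × Z)) (h1 : Γ.map Prod.fst ≤ P) (h2 : Γ.map Prod.snd ≤ Q) :
    wasserstein c P Q ≤ ∫⁻ p, ENNReal.ofReal (c p.1 p.2) ∂Γ
      + ENNReal.ofReal C * (1 - Γ Set.univ) := by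
  have m1 : (Γ.map Prod.fst) Set.univ = Γ Set.univ := by
    rw [Measure.map_apply measurable_fst MeasurableSet.univ, Set.preimage_univ]
  have m2 : (Γ.map Prod.snd) Set.univ = Γ Set.univ := by
    rw [Measure.map_apply measurable_snd MeasurableSet.univ, Set.preimage_univ]
  have hle : Γ Set.univ ≤ 1 := by
    rw [← m1]; exact (h1 Set.univ).trans prob_le_one
  have : IsFiniteMeasure Γ := ⟨hle.trans_lt one_lt_top⟩
  set R1 := P - Γ.map Prod.fst with hR1
  set R2 := Q - Γ.map Prod.snd with hR2
  have e1 : R1 + Γ.map Prod.fst = P := Measure.sub_add_cancel_of_le h1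
  have e2 : R2 + Γ.map Prod.snd = Q := Measure.sub_add_cancel_of_le h2
  set r := 1 - Γ Set.univ with hr
  have r1 : R1 Set.univ = r := by
    rw [hR1, Measure.sub_apply MeasurableSet.univ h1, m1, measure_univ]
  have r2 : R2 Set.univ = r := by
    rw [hR2, Measure.sub_apply MeasurableSet.univ h2, m2, measure_univ]
  have rtop : r ≠ ∞ := (tsub_le_self.trans_lt one_lt_top).ne
  have : IsFiniteMeasure R1 := ⟨by rw [r1]; exact rtop.lt_top⟩
  have : IsFiniteMeasure R2 := ⟨by rw [r2]; exact rtop.lt_top⟩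
  have s1 : r⁻¹ • r • R1 = R1 := by
    by_cases h0 : r = 0
    · rw [h0] at r1
      rw [Measure.measure_univ_eq_zero.1 r1]; simp
    · rw [smul_smul, ENNReal.inv_mul_cancel h0 rtop, one_smul]
  have s2 : r⁻¹ • r • R2 = R2 := by
    by_cases h0 : r = 0
    · rw [h0] at r2
      rw [Measure.measure_univ_eq_zero.1 r2]; simp
    · rw [smul_smul, ENNReal.inv_mul_cancel h0 rtop, one_smul]
  have f1 : (Γ + r⁻¹ • R1.prod R2).map Prod.fst = P := by
    rw [Measure.map_add _ _ measurable_fst, Measure.map_smul, Measure.map_fst_prod, r2, s1,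
      add_comm, e1]
  have f2 : (Γ + r⁻¹ • R1.prod R2).map Prod.snd = Q := by
    rw [Measure.map_add _ _ measurable_snd, Measure.map_smul, Measure.map_snd_prod, r1, s2,
      add_comm, e2]
  have hprob : IsProbabilityMeasure (Γ + r⁻¹ • R1.prod R2) := by
    constructor
    rw [← Set.preimage_univ (f := Prod.fst), ← Measure.map_apply measurable_fst MeasurableSet.univ,
      f1, measure_univ]
  have mm : (r⁻¹ • R1.prod R2) Set.univ = r := by
    have := congrArg (fun μ : Measure Z => μ Set.univ) s1
    simp only [Measure.smul_apply, r1, smul_eq_mul] at this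
    rw [Measure.smul_apply, ← Set.univ_prod_univ, Measure.prod_prod, r1, r2, smul_eq_mul, this]
  refine (iInf₂_le (Γ + r⁻¹ • R1.prod R2) ⟨hprob, f1, f2⟩).trans ?_
  rw [lintegral_add_measure]
  gcongr
  calc _ ≤ ∫⁻ p : Z × Z, ENNReal.ofReal C ∂(r⁻¹ • R1.prod R2) :=
        lintegral_mono fun p => ENNReal.ofReal_le_ofReal (hc _ _)
    _ = _ := by rw [lintegral_const, mm]

/-- Sub-couplings of joint laws built from a density with respect to the product kernel. -/
lemma wass_compProd_le_of_density {X Y : Type*} [MeasurableSpace X] [MeasurableSpace Y]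
    (c : X × Y → X × Y → ℝ) (hcm : Measurable (Function.uncurry c)) (C : ℝ)
    (hc : ∀ z z', c z z' ≤ C)
    (ρ : Measure X) [IsProbabilityMeasure ρ]
    (K₁ K₂ : Kernel X Y) [IsMarkovKernel K₁] [IsMarkovKernel K₂]
    (f : X → Y → Y → ℝ≥0∞) (hf : Measurable (fun p : X × Y × Y => f p.1 p.2.1 p.2.2))
    (hf1 : ∀ x y, ∫⁻ y', f x y y' ∂(K₂ x) ≤ 1) (hf2 : ∀ x y', ∫⁻ y, f x y y' ∂(K₁ x) ≤ 1) :
    wasserstein c (ρ.compProd K₁) (ρ.compProd K₂) ≤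
      ∫⁻ x, (∫⁻ y, ∫⁻ y', f x y y' * ENNReal.ofReal (c (x, y) (x, y')) ∂(K₂ x) ∂(K₁ x)
        + ENNReal.ofReal C * (1 - ∫⁻ y, ∫⁻ y', f x y y' ∂(K₂ x) ∂(K₁ x))) ∂ρ := by
  set M : Measure (X × Y × Y) :=
    (ρ.compProd (K₁ ×ₖ K₂)).withDensity (fun p => f p.1 p.2.1 p.2.2) with hM
  let φ : X × Y × Y → (X × Y) × (X × Y) := fun p => ((p.1, p.2.1), (p.1, p.2.2))
  have hφ : Measurable φ := by fun_prop
  -- integration formula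
  have key : ∀ g : (X × Y) × (X × Y) → ℝ≥0∞, Measurable g →
      ∫⁻ p, g p ∂(M.map φ) =
        ∫⁻ x, ∫⁻ y, ∫⁻ y', f x y y' * g ((x, y), (x, y')) ∂(K₂ x) ∂(K₁ x) ∂ρ := by
    intro g hg
    rw [lintegral_map hg hφ, hM]
    refine (lintegral_withDensity_eq_lintegral_mul _ hf (hg.comp hφ)).trans ?_
    rw [Measure.lintegral_compProd (hf.mul (hg.comp hφ))]
    refine lintegral_congr fun x => ?_
    rw [Kernel.prod_apply, lintegral_prod]
    · rfl
    · exact ((hf.mul (hg.comp hφ)).comp measurable_prodMk_left).aemeasurable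
  have hfx : ∀ x, Measurable (fun p : Y × Y => f x p.1 p.2) := fun x =>
    hf.comp (measurable_prodMk_left (x := x))
  have hcm' : Measurable fun p : (X × Y) × (X × Y) => ENNReal.ofReal (c p.1 p.2) :=
    hcm.ennreal_ofReal
  have b1 : (M.map φ).map Prod.fst ≤ ρ.compProd K₁ := by
    refine Measure.le_iff.2 fun s hs => ?_
    rw [← lintegral_indicator_one hs, ← lintegral_indicator_one hs,
      lintegral_map (measurable_one.indicator hs) measurable_fst,
      key (fun a => s.indicator 1 a.1)
        ((measurable_one.indicator hs).comp measurable_fst),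
      Measure.lintegral_compProd (measurable_one.indicator hs)]
    refine lintegral_mono fun x => lintegral_mono fun y => ?_
    dsimp only
    have hm : Measurable fun y' => f x y y' := (hfx x).comp measurable_prodMk_left
    rw [lintegral_mul_const _ hm]
    exact mul_le_of_le_one_left (by positivity) (hf1 x y)
  have b2 : (M.map φ).map Prod.snd ≤ ρ.compProd K₂ := by
    refine Measure.le_iff.2 fun s hs => ?_
    rw [← lintegral_indicator_one hs, ← lintegral_indicator_one hs,
      lintegral_map (measurable_one.indicator hs) measurable_snd,
      key (fun a => s.indicator 1 a.2)
        ((measurable_one.indicator hs).comp measurable_snd),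
      Measure.lintegral_compProd (measurable_one.indicator hs)]
    refine lintegral_mono fun x => ?_
    dsimp only
    rw [lintegral_lintegral_swap]
    · refine lintegral_mono fun y' => ?_
      dsimp only
      have hm : Measurable fun y => f x y y' := (hfx x).comp measurable_prodMk_right
      rw [lintegral_mul_const _ hm]
      exact mul_le_of_le_one_left (by positivity) (hf2 x y')
    · refine ((hfx x).mul ((measurable_one.indicator hs).comp ?_)).aemeasurable
      fun_prop
  refine (wass_le_of_subcoupling c C hc _ _ (M.map φ) b1 b2).trans ?_
  have hmass : (M.map φ) Set.univ = ∫⁻ x, ∫⁻ y, ∫⁻ y', f x y y' ∂(K₂ x) ∂(K₁ x) ∂ρ := by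
    rw [← lintegral_one, key (fun _ => 1) measurable_const]; simp
  have e : ∀ x, ∫⁻ y, ∫⁻ y', f x y y' ∂(K₂ x) ∂(K₁ x) = ∫⁻ p, f x p.1 p.2 ∂((K₁ ×ₖ K₂) x) := by
    intro x
    rw [Kernel.prod_apply, lintegral_prod _ (hfx x).aemeasurable]
  have hmm : Measurable fun x => ∫⁻ y, ∫⁻ y', f x y y' ∂(K₂ x) ∂(K₁ x) := by
    simp_rw [e]
    exact hf.lintegral_kernel_prod_right' (κ := K₁ ×ₖ K₂)
  have hle1 : ∀ x, ∫⁻ y, ∫⁻ y', f x y y' ∂(K₂ x) ∂(K₁ x) ≤ 1 := fun x =>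
    (lintegral_mono fun y => hf1 x y).trans (by simp)
  have hsub : Measurable fun x => 1 - ∫⁻ y, ∫⁻ y', f x y y' ∂(K₂ x) ∂(K₁ x) :=
    measurable_const.sub hmm
  rw [lintegral_add_right _ (hsub.const_mul _), lintegral_const_mul _ hsub, hmass, key _ hcm']
  gcongr
  rw [lintegral_sub hmm]
  · simp
  · exact ((lintegral_mono hle1).trans_lt (by simp)).ne
  · exact Eventually.of_forall hle1

/-- Discrete approximation from below of a coupling on `ℕ × ℕ` by a rational finitely supported
density. -/
lemma exists_rat_density (P Q : Measure ℕ) [IsProbabilityMeasure P] [IsProbabilityMeasure Q]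
    (γ : Measure (ℕ × ℕ)) [IsProbabilityMeasure γ] (h1 : γ.map Prod.fst = P)
    (h2 : γ.map Prod.snd = Q) (δ : ℝ≥0∞) (hδ : 0 < δ) :
    ∃ w : ℕ × ℕ →₀ ℚ≥0,
      (∀ i, ∫⁻ j, ((w (i, j) : NNReal) : ℝ≥0∞) ∂Q ≤ 1) ∧
      (∀ j, ∫⁻ i, ((w (i, j) : NNReal) : ℝ≥0∞) ∂P ≤ 1) ∧
      1 - δ ≤ ∫⁻ i, ∫⁻ j, ((w (i, j) : NNReal) : ℝ≥0∞) ∂Q ∂P ∧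
      ∀ D : ℕ → ℕ → ℝ≥0∞, ∫⁻ i, ∫⁻ j, ((w (i, j) : NNReal) : ℝ≥0∞) * D i j ∂Q ∂P
        ≤ ∫⁻ p, D p.1 p.2 ∂γ := by
  classical
  have g1 : ∀ i j, γ {(i, j)} ≤ P {i} := fun i j => by
    rw [← h1, Measure.map_apply measurable_fst (measurableSet_singleton _)]
    exact measure_mono (by simp)
  have g2 : ∀ i j, γ {(i, j)} ≤ Q {j} := fun i j => by
    rw [← h2, Measure.map_apply measurable_snd (measurableSet_singleton _)]
    exact measure_mono (by simp)
  have t1 : ∀ i, ∑' j, γ {(i, j)} = P {i} := fun i => by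
    rw [← h1, Measure.map_apply measurable_fst (measurableSet_singleton _),
      ← measure_iUnion]
    · congr 1; ext ⟨a, b⟩; simp [eq_comm]
    · intro a b hab; simp [Function.onFun, hab]
    · intro j; exact measurableSet_singleton _
  have t2 : ∀ j, ∑' i, γ {(i, j)} = Q {j} := fun j => by
    rw [← h2, Measure.map_apply measurable_snd (measurableSet_singleton _),
      ← measure_iUnion]
    · congr 1; ext ⟨a, b⟩; simp [eq_comm]
    · intro a b hab; simp [Function.onFun, hab]
    · intro j; exact measurableSet_singleton _
  have tot : ∑' p : ℕ × ℕ, γ {p} = 1 := by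
    have := lintegral_countable' (μ := γ) (fun _ => 1)
    simpa using this.symm
  -- pointwise rational approximations
  have hlt : ∀ t : ℝ≥0∞, t < 1 → ∀ p : ℕ × ℕ, ∃ q : ℚ≥0,
      (γ {p} = 0 → q = 0) ∧ ((q : NNReal) : ℝ≥0∞) * (P {p.1} * Q {p.2}) ≤ γ {p} ∧
      t * γ {p} ≤ ((q : NNReal) : ℝ≥0∞) * (P {p.1} * Q {p.2}) := by
    rintro t ht ⟨i, j⟩
    by_cases h0 : γ {(i, j)} = 0
    · exact ⟨0, by simp, by simp, by simp [h0]⟩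
    have hp : P {i} * Q {j} ≠ 0 := by
      refine mul_ne_zero (fun h => h0 ?_) (fun h => h0 ?_)
      · exact le_antisymm (h ▸ g1 i j) zero_le
      · exact le_antisymm (h ▸ g2 i j) zero_le
    have hp' : P {i} * Q {j} ≠ ∞ := ENNReal.mul_ne_top (measure_ne_top _ _) (measure_ne_top _ _)
    have hl : t * γ {(i, j)} / (P {i} * Q {j}) < γ {(i, j)} / (P {i} * Q {j}) := by
      refine ENNReal.div_lt_div_right hp hp' ?_
      calc t * γ {(i, j)} < 1 * γ {(i, j)} :=
            ENNReal.mul_lt_mul_left h0 (measure_ne_top _ _) ht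
        _ = _ := one_mul _
    obtain ⟨q, hq0, hq1, hq2⟩ := ENNReal.lt_iff_exists_rat_btwn.1 hl
    lift q to ℚ≥0 using hq0
    have hq : ENNReal.ofNNReal (Real.toNNReal ((q : ℚ) : ℝ)) = ((q : NNReal) : ℝ≥0∞) := by
      congr 1
      ext
      rw [Real.coe_toNNReal _ (by positivity)]
      rfl
    rw [hq] at hq1 hq2
    refine ⟨q, fun h => absurd h h0, ?_, ?_⟩
    · exact (ENNReal.le_div_iff_mul_le (Or.inl hp) (Or.inl hp')).1 hq2.le
    · exact (ENNReal.div_le_iff_le_mul (Or.inl hp) (Or.inl hp')).1 hq1.le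
  obtain ⟨t, ht1, F, hF⟩ : ∃ t < (1 : ℝ≥0∞), ∃ F : Finset (ℕ × ℕ),
      1 - δ ≤ t * ∑ p ∈ F, γ {p} := by
    have hd : (1 : ℝ≥0∞) - δ / 2 < 1 :=
      ENNReal.sub_lt_self one_ne_top one_ne_zero (ENNReal.half_pos hδ.ne').ne'
    have := hd
    rw [← tot, ENNReal.tsum_eq_iSup_sum, lt_iSup_iff] at this
    obtain ⟨F, hF⟩ := this
    rw [← ENNReal.tsum_eq_iSup_sum, tot] at hF
    refine ⟨1 - δ / 2, hd, F, ?_⟩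
    refine le_trans ?_ (mul_le_mul_right hF.le _)
    rw [tsub_le_iff_right]
    by_cases hb : δ / 2 ≤ 1
    · calc (1 : ℝ≥0∞) = (1 - δ / 2) * 1 + δ / 2 := by rw [mul_one, tsub_add_cancel_of_le hb]
        _ = (1 - δ / 2) * ((1 - δ / 2) + δ / 2) + δ / 2 := by rw [tsub_add_cancel_of_le hb]
        _ = (1 - δ / 2) * (1 - δ / 2) + ((1 - δ / 2) * (δ / 2) + δ / 2) := by ring
        _ ≤ (1 - δ / 2) * (1 - δ / 2) + (1 * (δ / 2) + δ / 2) := by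
            gcongr
        _ = _ := by rw [one_mul, ENNReal.add_halves]
    · refine le_add_left ((not_le.1 hb).le.trans ENNReal.half_le_self)
  choose q hq0 hq1 hq2 using hlt t ht1
  let w : ℕ × ℕ →₀ ℚ≥0 := Finsupp.onFinset F (fun p => if p ∈ F then q p else 0)
    (by intro p hp; by_contra h; simp [h] at hp)
  have hw0 : ∀ p, γ {p} = 0 → w p = 0 := by
    intro p hp
    simp [w, hq0 p hp]
  have hw : ∀ p, ((w p : NNReal) : ℝ≥0∞) * (P {p.1} * Q {p.2}) ≤ γ {p} := by
    intro p
    by_cases hp : p ∈ F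
    · simpa [w, hp] using hq1 p
    · simp [w, hp]
  have cnt : ∀ g : ℕ → ℕ → ℝ≥0∞, ∫⁻ i, ∫⁻ j, g i j ∂Q ∂P
      = ∑' p : ℕ × ℕ, g p.1 p.2 * (P {p.1} * Q {p.2}) := by
    intro g
    rw [lintegral_countable', ENNReal.tsum_prod']
    refine tsum_congr fun i => ?_
    rw [lintegral_countable', ← ENNReal.tsum_mul_right]
    refine tsum_congr fun j => ?_
    ring
  refine ⟨w, ?_, ?_, ?_, ?_⟩
  · intro i
    by_cases h0 : P {i} = 0
    · have : ∀ j, w (i, j) = 0 := fun j => hw0 _ (le_antisymm (h0 ▸ g1 i j) zero_le)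
      simp [this]
    · refine (ENNReal.mul_le_mul_iff_right h0 (measure_ne_top P {i})).1 ?_
      rw [mul_one, lintegral_countable', ← ENNReal.tsum_mul_left]
      conv_rhs => rw [← t1 i]
      refine ENNReal.tsum_le_tsum fun j => ?_
      calc _ = ((w (i, j) : NNReal) : ℝ≥0∞) * (P {i} * Q {j}) := by ring
        _ ≤ _ := hw (i, j)
  · intro j
    by_cases h0 : Q {j} = 0
    · have : ∀ i, w (i, j) = 0 := fun i => hw0 _ (le_antisymm (h0 ▸ g2 i j) zero_le)
      simp [this]
    · refine (ENNReal.mul_le_mul_iff_right h0 (measure_ne_top Q {j})).1 ?_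
      rw [mul_one, lintegral_countable', ← ENNReal.tsum_mul_left]
      conv_rhs => rw [← t2 j]
      refine ENNReal.tsum_le_tsum fun i => ?_
      calc _ = ((w (i, j) : NNReal) : ℝ≥0∞) * (P {i} * Q {j}) := by ring
        _ ≤ _ := hw (i, j)
  · rw [cnt]
    refine hF.trans ?_
    rw [Finset.mul_sum]
    refine le_trans (Finset.sum_le_sum fun p hp => ?_) (ENNReal.sum_le_tsum F)
    simpa [w, hp] using hq2 p
  · intro D
    rw [cnt, lintegral_countable']
    refine ENNReal.tsum_le_tsum fun p => ?_
    calc _ = D p.1 p.2 * (((w p : NNReal) : ℝ≥0∞) * (P {p.1} * Q {p.2})) := by ring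
      _ ≤ _ := by gcongr; exact hw p

/-- Pointwise approximation of a coupling by one of countably many densities. -/
lemma exists_good_density {Y : Type*} [MetricSpace Y] [SecondCountableTopology Y]
    [MeasurableSpace Y] [BorelSpace Y] (P Q : Measure Y) [IsProbabilityMeasure P]
    [IsProbabilityMeasure Q] (idx : Y → ℕ) (hidx : Measurable idx) (a : ℕ → Y) (η C : ℝ≥0∞)
    (hη : 0 < η) (hC : C ≠ ∞) (ha : ∀ y, edist y (a (idx y)) ≤ η)
    (γ : Measure (Y × Y)) [IsProbabilityMeasure γ] (h1 : γ.map Prod.fst = P)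
    (h2 : γ.map Prod.snd = Q) :
    ∃ w : ℕ × ℕ →₀ ℚ≥0,
      (∀ i, ∫⁻ y', ((w (i, idx y') : NNReal) : ℝ≥0∞) ∂Q ≤ 1) ∧
      (∀ j, ∫⁻ y, ((w (idx y, j) : NNReal) : ℝ≥0∞) ∂P ≤ 1) ∧
      ∫⁻ y, ∫⁻ y', ((w (idx y, idx y') : NNReal) : ℝ≥0∞) * ENNReal.ofReal (dist y y') ∂Q ∂P
        + C * (1 - ∫⁻ y, ∫⁻ y', ((w (idx y, idx y') : NNReal) : ℝ≥0∞) ∂Q ∂P)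
        ≤ ∫⁻ p, ENNReal.ofReal (dist p.1 p.2) ∂γ + 5 * η := by
  have hpm : Measurable (Prod.map idx idx) := hidx.prodMap hidx
  have : IsProbabilityMeasure (P.map idx) := Measure.isProbabilityMeasure_map hidx.aemeasurable
  have : IsProbabilityMeasure (Q.map idx) := Measure.isProbabilityMeasure_map hidx.aemeasurable
  have : IsProbabilityMeasure (γ.map (Prod.map idx idx)) :=
    Measure.isProbabilityMeasure_map hpm.aemeasurable
  have k1 : (γ.map (Prod.map idx idx)).map Prod.fst = P.map idx := by
    rw [Measure.map_map measurable_fst hpm, ← h1, Measure.map_map hidx measurable_fst]; rfl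
  have k2 : (γ.map (Prod.map idx idx)).map Prod.snd = Q.map idx := by
    rw [Measure.map_map measurable_snd hpm, ← h2, Measure.map_map hidx measurable_snd]; rfl
  have hC1 : C + 1 ≠ ∞ := ENNReal.add_ne_top.2 ⟨hC, one_ne_top⟩
  have hδ : 0 < η / (C + 1) := ENNReal.div_pos hη.ne' hC1
  obtain ⟨w, w1, w2, w3, w4⟩ := exists_rat_density (P.map idx) (Q.map idx)
    (γ.map (Prod.map idx idx)) k1 k2 _ hδ
  have m1 : ∀ g : ℕ → ℝ≥0∞, Measurable g := fun g => measurable_from_top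
  have dbl : ∀ g : ℕ → ℕ → ℝ≥0∞, ∫⁻ i, ∫⁻ j, g i j ∂(Q.map idx) ∂(P.map idx)
      = ∫⁻ y, ∫⁻ y', g (idx y) (idx y') ∂Q ∂P := by
    intro g
    rw [lintegral_map (m1 _) hidx]
    refine lintegral_congr fun y => ?_
    rw [lintegral_map (m1 _) hidx]
  have w1' : ∀ i, ∫⁻ y', ((w (i, idx y') : NNReal) : ℝ≥0∞) ∂Q ≤ 1 := by
    intro i
    have := w1 i
    rwa [lintegral_map (m1 _) hidx] at this
  have w2' : ∀ j, ∫⁻ y, ((w (idx y, j) : NNReal) : ℝ≥0∞) ∂P ≤ 1 := by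
    intro j
    have := w2 j
    rwa [lintegral_map (m1 fun i => ((w (i, j) : NNReal) : ℝ≥0∞)) hidx] at this
  refine ⟨w, w1', w2', ?_⟩
  rw [dbl fun i j => ((w (i, j) : NNReal) : ℝ≥0∞)] at w3
  have w4' := w4 fun i j => edist (a i) (a j)
  rw [dbl fun i j => ((w (i, j) : NNReal) : ℝ≥0∞) * edist (a i) (a j),
    lintegral_map (measurable_of_countable _) hpm] at w4'
  simp only [Prod.map_fst, Prod.map_snd] at w4'
  simp_rw [← edist_dist]
  have d1 : ∀ y y', edist y y' ≤ edist (a (idx y)) (a (idx y')) + 2 * η := by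
    intro y y'
    calc edist y y' ≤ edist y (a (idx y)) + edist (a (idx y)) (a (idx y')) + edist (a (idx y')) y' :=
          edist_triangle4 _ _ _ _
      _ ≤ η + edist (a (idx y)) (a (idx y')) + η := by
          gcongr
          · exact ha y
          · rw [edist_comm]; exact ha y'
      _ = _ := by ring
  have d2 : ∀ y y', edist (a (idx y)) (a (idx y')) ≤ edist y y' + 2 * η := by
    intro y y'
    calc edist (a (idx y)) (a (idx y')) ≤
          edist (a (idx y)) y + edist y y' + edist y' (a (idx y')) := edist_triangle4 _ _ _ _
      _ ≤ η + edist y y' + η := by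
          gcongr
          · rw [edist_comm]; exact ha y
          · exact ha y'
      _ = _ := by ring
  have mass1 : ∫⁻ y, ∫⁻ y', ((w (idx y, idx y') : NNReal) : ℝ≥0∞) ∂Q ∂P ≤ 1 :=
    (lintegral_mono fun y => w1' (idx y)).trans (by simp)
  have mm : ∀ g : ℕ → ℕ → ℝ≥0∞, Measurable fun p : Y × Y => g (idx p.1) (idx p.2) := by
    intro g
    exact (measurable_of_countable (fun p : ℕ × ℕ => g p.1 p.2)).comp hpm
  have c1 : ∫⁻ y, ∫⁻ y', ((w (idx y, idx y') : NNReal) : ℝ≥0∞) * edist y y' ∂Q ∂P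
      ≤ ∫⁻ y, ∫⁻ y', ((w (idx y, idx y') : NNReal) : ℝ≥0∞) * edist (a (idx y)) (a (idx y')) ∂Q ∂P
        + 2 * η := by
    calc _ ≤ ∫⁻ y, ∫⁻ y', (((w (idx y, idx y') : NNReal) : ℝ≥0∞)
              * edist (a (idx y)) (a (idx y')) + ((w (idx y, idx y') : NNReal) : ℝ≥0∞) * (2 * η))
              ∂Q ∂P := by
          refine lintegral_mono fun y => lintegral_mono fun y' => ?_
          dsimp only
          rw [← mul_add]
          gcongr
          exact d1 y y'
      _ ≤ ∫⁻ y, (∫⁻ y', ((w (idx y, idx y') : NNReal) : ℝ≥0∞)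
              * edist (a (idx y)) (a (idx y')) ∂Q + 2 * η) ∂P := by
          refine lintegral_mono fun y => ?_
          dsimp only
          have hm : Measurable fun y' => ((w (idx y, idx y') : NNReal) : ℝ≥0∞) :=
            (m1 fun j => ((w (idx y, j) : NNReal) : ℝ≥0∞)).comp hidx
          rw [lintegral_add_right _ (hm.mul_const _), lintegral_mul_const _ hm]
          refine add_le_add le_rfl ?_
          exact mul_le_of_le_one_left (by positivity) (w1' _)
      _ = _ := by
          rw [lintegral_add_right _ measurable_const]; simp
  have c2 : ∫⁻ p : Y × Y, edist (a (idx p.1)) (a (idx p.2)) ∂γ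
      ≤ ∫⁻ p : Y × Y, edist p.1 p.2 ∂γ + 2 * η := by
    calc _ ≤ ∫⁻ p : Y × Y, (edist p.1 p.2 + 2 * η) ∂γ := lintegral_mono fun p => d2 _ _
      _ = _ := by rw [lintegral_add_right _ measurable_const]; simp
  have c3 : C * (1 - ∫⁻ y, ∫⁻ y', ((w (idx y, idx y') : NNReal) : ℝ≥0∞) ∂Q ∂P) ≤ η := by
    calc _ ≤ (C + 1) * (η / (C + 1)) := by
          gcongr
          · exact le_self_add
          · exact tsub_le_iff_tsub_le.1 w3
      _ ≤ η := ENNReal.mul_div_le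
  calc _ ≤ ((∫⁻ p : Y × Y, edist p.1 p.2 ∂γ + 2 * η) + 2 * η) + η := by
        gcongr
        refine c1.trans ?_
        gcongr
        exact w4'.trans c2
    _ = _ := by ring

/-- **Joint laws built from a common base measure and two kernels.**
For Polish metric spaces `X`, `Y` with bounded metrics, a probability measure
`ρ` on `X` and Markov kernels `K₁, K₂` from `X` to `Y`, the Wasserstein
distance between the joint laws `μ_i(dx, dy) = ρ(dx) K_i(dy|x)` (w.r.t. the
sum metric on `X × Y`) is at most the expected Wasserstein distance between
the conditional distributions. -/
theorem wasserstein_compProd_le_lintegral_wasserstein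
    {X Y : Type*}
    [MetricSpace X] [CompleteSpace X] [SecondCountableTopology X]
    [MeasurableSpace X] [BorelSpace X]
    [MetricSpace Y] [CompleteSpace Y] [SecondCountableTopology Y]
    [MeasurableSpace Y] [BorelSpace Y]
    (hXbdd : ∃ C, ∀ x x' : X, dist x x' ≤ C)
    (hYbdd : ∃ C, ∀ y y' : Y, dist y y' ≤ C)
    (ρ : Measure X) [IsProbabilityMeasure ρ]
    (K₁ K₂ : Kernel X Y) [IsMarkovKernel K₁] [IsMarkovKernel K₂] :
    wasserstein (fun p q : X × Y => dist p.1 q.1 + dist p.2 q.2)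
        (ρ.compProd K₁) (ρ.compProd K₂)
      ≤ ∫⁻ x, wasserstein dist (K₁ x) (K₂ x) ∂ρ := by
  classical
  obtain ⟨CX, hCX⟩ := hXbdd
  obtain ⟨CY, hCY⟩ := hYbdd
  have hX : Nonempty X := ρ.nonempty_of_neZero
  obtain ⟨x₀⟩ := hX
  have hY : Nonempty Y := (K₁ x₀).nonempty_of_neZero
  refine ENNReal.le_of_forall_pos_le_add fun ε hε _ => ?_
  set η : ℝ≥0∞ := (ε : ℝ≥0∞) / 6 with hηdef
  have hη : 0 < η := ENNReal.div_pos (by exact_mod_cast hε.ne') (by simp)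
  have hηtop : η ≠ ∞ := ENNReal.div_ne_top coe_ne_top (by simp)
  have h6 : 6 * η = ε := ENNReal.mul_div_cancel (by simp) (by simp)
  set C : ℝ≥0∞ := ENNReal.ofReal (CX + CY) with hCdef
  have hC : C ≠ ∞ := ENNReal.ofReal_ne_top
  -- the measurable discretisation
  let a : ℕ → Y := TopologicalSpace.denseSeq Y
  have hex : ∀ y : Y, ∃ n, edist y (a n) < η := by
    intro y
    obtain ⟨_, ⟨n, rfl⟩, hn⟩ := EMetric.mem_closure_iff.1
      (TopologicalSpace.denseRange_denseSeq Y y) η hη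
    exact ⟨n, hn⟩
  let idx : Y → ℕ := fun y => Nat.find (hex y)
  have hidx : Measurable idx := measurable_find hex fun k =>
    measurableSet_lt (measurable_id.edist measurable_const) measurable_const
  have ha : ∀ y, edist y (a (idx y)) ≤ η := fun y => (Nat.find_spec (hex y)).le
  have hpm : Measurable (Prod.map idx idx) := hidx.prodMap hidx
  obtain ⟨e, he⟩ := exists_surjective_nat (ℕ × ℕ →₀ ℚ≥0)
  let w : ℕ → ℕ → ℕ → ℝ≥0∞ := fun k i j => ((e k (i, j) : NNReal) : ℝ≥0∞)
  let cond : ℕ → X → Prop := fun k x =>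
    (∀ i, ∫⁻ y', w k i (idx y') ∂(K₂ x) ≤ 1) ∧ (∀ j, ∫⁻ y, w k (idx y) j ∂(K₁ x) ≤ 1)
  let cost : ℕ → X → ℝ≥0∞ := fun k x =>
    ∫⁻ y, ∫⁻ y', w k (idx y) (idx y') * ENNReal.ofReal (dist y y') ∂(K₂ x) ∂(K₁ x)
      + C * (1 - ∫⁻ y, ∫⁻ y', w k (idx y) (idx y') ∂(K₂ x) ∂(K₁ x))
  let G : ℕ → X → ℝ≥0∞ := fun k x => if cond k x then cost k x else ∞
  have mdbl : ∀ g : Y → Y → ℝ≥0∞, Measurable (fun p : Y × Y => g p.1 p.2) →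
      Measurable fun x => ∫⁻ y, ∫⁻ y', g y y' ∂(K₂ x) ∂(K₁ x) := by
    intro g hg
    have h : ∀ x, ∫⁻ y, ∫⁻ y', g y y' ∂(K₂ x) ∂(K₁ x) = ∫⁻ p, g p.1 p.2 ∂((K₁ ×ₖ K₂) x) := by
      intro x
      rw [Kernel.prod_apply, lintegral_prod _ hg.aemeasurable]
    simp_rw [h]
    exact hg.lintegral_kernel
  have mw : ∀ k, Measurable fun p : Y × Y => w k (idx p.1) (idx p.2) := fun k =>
    (measurable_of_countable (fun p : ℕ × ℕ => w k p.1 p.2)).comp hpm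
  have mcond : ∀ k, MeasurableSet {x | cond k x} := by
    intro k
    refine MeasurableSet.inter ?_ ?_
    · refine MeasurableSet.congr (MeasurableSet.iInter fun i => measurableSet_le
        (f := fun x => ∫⁻ y', w k i (idx y') ∂(K₂ x)) (g := fun _ => 1) ?_ measurable_const) ?_
      · exact ((measurable_of_countable (w k i)).comp hidx).lintegral_kernel
      · ext x; simp; rfl
    · refine MeasurableSet.congr (MeasurableSet.iInter fun j => measurableSet_le
        (f := fun x => ∫⁻ y, w k (idx y) j ∂(K₁ x)) (g := fun _ => 1) ?_ measurable_const) ?_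
      · exact ((measurable_of_countable (fun i => w k i j)).comp hidx).lintegral_kernel
      · ext x; simp; rfl
  have mcost : ∀ k, Measurable (cost k) := by
    intro k
    refine Measurable.add ?_ (Measurable.const_mul (measurable_const.sub ?_) _)
    · exact mdbl (fun y y' => w k (idx y) (idx y') * ENNReal.ofReal (dist y y'))
        ((mw k).mul (measurable_fst.dist measurable_snd).ennreal_ofReal)
    · exact mdbl (fun y y' => w k (idx y) (idx y')) (mw k)
  have mG : ∀ k, Measurable (G k) := fun k =>
    Measurable.ite (mcond k) (mcost k) measurable_const
  let J : X → ℝ≥0∞ := fun x => ⨅ k, G k x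
  have mJ : Measurable J := Measurable.iInf mG
  have hJtop : ∀ x, J x ≠ ∞ := by
    intro x
    obtain ⟨k, hk⟩ := he 0
    have hw0 : ∀ i j, w k i j = 0 := by intro i j; simp [w, hk]
    refine ((iInf_le _ k).trans_lt ?_).ne
    have hcd : cond k x := by simp [cond, hw0]
    simp [G, hcd, cost, hw0, hC.lt_top]
  have hJW : ∀ x, J x ≤ wasserstein dist (K₁ x) (K₂ x) + 5 * η := by
    intro x
    rw [← tsub_le_iff_right]
    refine le_iInf₂ fun γ hγ => ?_
    obtain ⟨hγ0, hγ1, hγ2⟩ := hγ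
    rw [tsub_le_iff_right]
    obtain ⟨v, v1, v2, v3⟩ := exists_good_density (K₁ x) (K₂ x) idx hidx a η C hη hC ha γ hγ1 hγ2
    obtain ⟨k, rfl⟩ := he v
    refine (iInf_le _ k).trans ?_
    have hcd : cond k x := ⟨v1, v2⟩
    simp only [G, hcd, if_true]
    exact v3
  -- measurable selection
  have hsel : ∀ x, ∃ k, G k x < J x + η := fun x =>
    iInf_lt_iff.1 (ENNReal.lt_add_right (hJtop x) hη.ne')
  let κ : X → ℕ := fun x => Nat.find (hsel x)
  have hκ : Measurable κ := measurable_find hsel fun k =>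
    measurableSet_lt (mG k) (mJ.add_const _)
  have hκs : ∀ x, G (κ x) x < J x + η := fun x => Nat.find_spec (hsel x)
  have hκc : ∀ x, cond (κ x) x := by
    intro x
    by_contra h
    have := hκs x
    simp [G, h] at this
  have hκG : ∀ x, cost (κ x) x ≤ wasserstein dist (K₁ x) (K₂ x) + ε := by
    intro x
    have h := (hκs x).le
    simp only [G, hκc x, if_true] at h
    refine h.trans ((add_le_add_left (hJW x) _).trans_eq ?_)
    rw [← h6]; ring
  have hfm : Measurable fun p : X × Y × Y => w (κ p.1) (idx p.2.1) (idx p.2.2) := by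
    refine (measurable_of_countable (fun p : ℕ × ℕ × ℕ => w p.1 p.2.1 p.2.2)).comp
      (g := fun p : ℕ × ℕ × ℕ => w p.1 p.2.1 p.2.2)
      (f := fun p : X × Y × Y => (κ p.1, idx p.2.1, idx p.2.2)) ?_
    fun_prop
  have hcm : Measurable (Function.uncurry
      (fun p q : X × Y => dist p.1 q.1 + dist p.2 q.2)) := by
    refine Measurable.add ?_ ?_
    · exact Measurable.dist (by fun_prop) (by fun_prop)
    · exact Measurable.dist (by fun_prop) (by fun_prop)
  refine (wass_compProd_le_of_density _ hcm (CX + CY)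
    (fun z z' => add_le_add (hCX _ _) (hCY _ _)) ρ K₁ K₂
    (fun x y y' => w (κ x) (idx y) (idx y')) hfm (fun x y => (hκc x).1 _)
    (fun x y' => (hκc x).2 _)).trans ?_
  calc _ = ∫⁻ x, cost (κ x) x ∂ρ := by
        refine lintegral_congr fun x => ?_
        simp [cost, C]
    _ ≤ ∫⁻ x, (wasserstein dist (K₁ x) (K₂ x) + ε) ∂ρ := lintegral_mono hκG
    _ = _ := by rw [lintegral_add_right _ measurable_const]; simp
end
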